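/- For every ε > 0 there exists T₀ such that for all T ≥ T₀, the number of primes p ≤ T for which X*(p) is not a single Γ-orbit (i.e. for which strong approximation fails) is at most T^ε. -/

import Mathlib

/-- One step of the Markoff group action: `b` is obtained from `a` by a coordinate
transposition or by one of the three Vieta involutions. -/
def MarkoffStep (p : ℕ) (a b : ZMod p × ZMod p × ZMod p) : Prop :=
  b = (a.2.1, a.1, a.2.2) ∨
  b = (a.1, a.2.2, a.2.1) ∨
  b = (a.2.2, a.2.1, a.1) ∨
  b = (3 * a.2.1 * a.2.2 - a.1, a.2.1, a.2.2) ∨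
  b = (a.1, 3 * a.1 * a.2.2 - a.2.1, a.2.2) ∨
  b = (a.1, a.2.1, 3 * a.1 * a.2.1 - a.2.2)

/-- The Markoff surface mod `p`. -/
def MarkoffX (p : ℕ) : Set (ZMod p × ZMod p × ZMod p) :=
  {x | x.1 ^ 2 + x.2.1 ^ 2 + x.2.2 ^ 2 = 3 * x.1 * x.2.1 * x.2.2}

/-- The punctured Markoff surface `X*(p)`. -/
def MarkoffXstar (p : ℕ) : Set (ZMod p × ZMod p × ZMod p) :=
  MarkoffX p \ {(0, 0, 0)}

/-- The `Γ`-orbit of a point: the equivalence class under the equivalence relation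
generated by the coordinate permutations and the Vieta involutions. -/
def markoffOrbit (p : ℕ) (x : ZMod p × ZMod p × ZMod p) : Set (ZMod p × ZMod p × ZMod p) :=
  {y | Relation.EqvGen (MarkoffStep p) x y}


/-- Strong approximation holds at `p`: `X*(p)` is a single `Γ`-orbit. -/
def MarkoffStrongApprox (p : ℕ) : Prop :=
  (MarkoffXstar p).Nonempty ∧
    ∀ x ∈ MarkoffXstar p, ∀ y ∈ MarkoffXstar p, Relation.EqvGen (MarkoffStep p) x y

theorem exists_card_divisors_le_rpow {δ : ℝ} (hδ : 0 < δ) :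
    ∃ C : ℝ, 1 ≤ C ∧ ∀ n : ℕ, n ≠ 0 → (n.divisors.card : ℝ) ≤ C * (n : ℝ) ^ δ := by
  have hlog : 0 < Real.log 2 := Real.log_pos one_lt_two
  obtain ⟨B, hB⟩ := exists_nat_ge ((2 : ℝ) ^ (1 / δ))
  set K : ℝ := 1 + 1 / (δ * Real.log 2) with hK
  have hK1 : 1 ≤ K := by
    have : 0 < 1 / (δ * Real.log 2) := by positivity
    linarith
  refine ⟨K ^ B, one_le_pow₀ hK1, fun n hn => ?_⟩
  have hfac (x : ℕ) (hx : x.Prime) (e : ℕ) :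
      (e + 1 : ℝ) ≤ (if x < B then K else 1) * ((x : ℝ) ^ e) ^ δ := by
    have hx2 : (2 : ℝ) ≤ x := by exact_mod_cast hx.two_le
    have hx0 : (0 : ℝ) ≤ x := by positivity
    rw [← Real.rpow_natCast, ← Real.rpow_mul hx0, mul_comm (e : ℝ) δ]
    split_ifs with h
    · have h1 : (1 + δ * e * Real.log 2 : ℝ) ≤ (2 : ℝ) ^ (δ * e) := by
        rw [Real.rpow_def_of_pos two_pos]
        have := Real.add_one_le_exp (Real.log 2 * (δ * e))
        linarith
      have h3 : (2 : ℝ) ^ (δ * e) ≤ (x : ℝ) ^ (δ * e) :=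
        Real.rpow_le_rpow two_pos.le hx2 (by positivity)
      have h4 : (e + 1 : ℝ) ≤ K * (1 + δ * e * Real.log 2) := by
        have : K * (1 + δ * e * Real.log 2) =
            1 + 1 / (δ * Real.log 2) + e + δ * e * Real.log 2 := by
          rw [hK]
          field_simp
          ring
        rw [this]
        have : 0 ≤ 1 / (δ * Real.log 2) := by positivity
        have : 0 ≤ δ * e * Real.log 2 := by positivity
        linarith
      calc (e + 1 : ℝ) ≤ K * (1 + δ * e * Real.log 2) := h4
        _ ≤ K * (x : ℝ) ^ (δ * e) := by gcongr; exact h1.trans h3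
    · have h1 : (2 : ℝ) ≤ (x : ℝ) ^ δ := by
        have h3 : (2 : ℝ) ^ (1 / δ) ≤ x := hB.trans (by exact_mod_cast not_lt.1 h)
        have h4 := Real.rpow_le_rpow (by positivity) h3 hδ.le
        rwa [← Real.rpow_mul two_pos.le, one_div_mul_cancel hδ.ne', Real.rpow_one] at h4
      rw [one_mul, Real.rpow_mul hx0, Real.rpow_natCast]
      calc (e + 1 : ℝ) ≤ 2 ^ e := by exact_mod_cast Nat.lt_two_pow_self
        _ ≤ ((x : ℝ) ^ δ) ^ e := by gcongr
  have hprod : (n : ℝ) ^ δ = ∏ x ∈ n.primeFactors, ((x : ℝ) ^ n.factorization x) ^ δ := by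
    rw [Real.finsetProd_rpow _ _ fun i _ => by positivity]
    congr 1
    conv_lhs => rw [← Nat.prod_factorization_pow_eq_self hn]
    rw [Finsupp.prod, Nat.support_factorization]
    push_cast
    rfl
  rw [Nat.card_divisors hn, hprod]
  push_cast
  calc ∏ x ∈ n.primeFactors, ((n.factorization x : ℝ) + 1)
      ≤ ∏ x ∈ n.primeFactors, ((if x < B then K else 1) * ((x : ℝ) ^ n.factorization x) ^ δ) :=
        Finset.prod_le_prod (fun _ _ => by positivity)
          fun x hx => hfac x (Nat.prime_of_mem_primeFactors hx) _
    _ = (∏ x ∈ n.primeFactors, if x < B then K else 1) *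
        ∏ x ∈ n.primeFactors, ((x : ℝ) ^ n.factorization x) ^ δ := Finset.prod_mul_distrib
    _ ≤ _ := by
      refine mul_le_mul_of_nonneg_right ?_ (Finset.prod_nonneg fun _ _ => by positivity)
      rw [Finset.prod_ite, Finset.prod_const, Finset.prod_const_one, mul_one]
      refine pow_le_pow_right₀ hK1 ?_
      calc _ ≤ (Finset.range B).card := Finset.card_le_card fun x hx => by
            simpa using (Finset.mem_filter.1 hx).2
        _ = B := Finset.card_range B

section Quartic

open Polynomial

variable {F : Type*} [Field F]

/-- The polynomial `(a X² + b)² - 4 X²`. -/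
noncomputable def conicQuartic (a b : F) : F[X] := (C a * X ^ 2 + C b) ^ 2 - 4 * X ^ 2

/-- The coordinate ring of the curve `s² = (a X² + b)² - 4 X²`. -/
abbrev ConicRing (a b : F) : Type _ := QuadraticAlgebra F[X] (conicQuartic a b) 0

/-- The derivation of `ConicRing a b` that sends `X` to `X * ω`. -/
noncomputable def conicDeriv (a b : F) : ConicRing a b →ₗ[F] ConicRing a b where
  toFun z := ⟨X * conicQuartic a b * derivative z.im +
      (2 * C a * X ^ 2 * (C a * X ^ 2 + C b) - 4 * X ^ 2) * z.im, X * derivative z.re⟩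
  map_add' z w := by ext1 <;> simp <;> ring
  map_smul' c z := by
    ext1 <;> simp [smul_eq_C_mul] <;> ring

theorem conicDeriv_re {a b : F} (z : ConicRing a b) :
    (conicDeriv a b z).re = X * conicQuartic a b * derivative z.im +
      (2 * C a * X ^ 2 * (C a * X ^ 2 + C b) - 4 * X ^ 2) * z.im := rfl

theorem conicDeriv_im {a b : F} (z : ConicRing a b) :
    (conicDeriv a b z).im = X * derivative z.re := rfl

theorem X_mul_derivative_conicQuartic (a b : F) : X * derivative (conicQuartic a b) =
    2 * (2 * C a * X ^ 2 * (C a * X ^ 2 + C b) - 4 * X ^ 2) := by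
  simp only [conicQuartic, derivative_sub, derivative_pow, derivative_mul, derivative_add,
    derivative_C, derivative_X, derivative_ofNat]
  simp [show (C 2 : F[X]) = 2 from rfl]
  ring

theorem conicDeriv_mul {a b : F} (z w : ConicRing a b) :
    conicDeriv a b (z * w) = conicDeriv a b z * w + z * conicDeriv a b w := by
  have h := X_mul_derivative_conicQuartic a b
  ext1
  · simp only [conicDeriv_re, QuadraticAlgebra.re_mul, QuadraticAlgebra.im_mul, conicDeriv_im,
      QuadraticAlgebra.re_add, derivative_add, derivative_mul, derivative_zero]
    ring
  · simp only [conicDeriv_re, QuadraticAlgebra.re_mul, QuadraticAlgebra.im_mul, conicDeriv_im,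
      QuadraticAlgebra.im_add, derivative_add, derivative_mul]
    linear_combination z.im * w.im * h

/-- The operator conjugate to `conicDeriv` under multiplication by a function with logarithmic
derivative `α ω + β (a X² - b)`. -/
noncomputable def conicTwist (a b α β : F) : Module.End F (ConicRing a b) :=
  conicDeriv a b + LinearMap.mulLeft F ⟨C β * (C a * X ^ 2 - C b), C α⟩

theorem conicTwist_apply {a b α β : F} (z : ConicRing a b) :
    conicTwist a b α β z = conicDeriv a b z + ⟨C β * (C a * X ^ 2 - C b), C α⟩ * z := rfl

theorem conicDeriv_pow_mul {a b α β : F} (e : ConicRing a b)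
    (he : conicDeriv a b e = e * ⟨C β * (C a * X ^ 2 - C b), C α⟩) (n : ℕ) (z : ConicRing a b) :
    ((conicDeriv a b : Module.End F _) ^ n) (e * z) = e * (conicTwist a b α β ^ n) z := by
  induction n generalizing z with
  | zero => simp
  | succ n ih =>
    rw [pow_succ, pow_succ, Module.End.mul_apply, Module.End.mul_apply, conicDeriv_mul, he,
      conicTwist_apply, ← ih]
    congr 1
    ring

/-- The function `X`. -/
noncomputable def conicX (a b : F) : ConicRing a b := ⟨X, 0⟩

/-- The function `(a X² + b + ω) / 2`. -/
noncomputable def conicG (a b : F) : ConicRing a b :=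
  ⟨C (2⁻¹) * (C a * X ^ 2 + C b), C 2⁻¹⟩

theorem conicDeriv_X (a b : F) : conicDeriv a b (conicX a b) = conicX a b * ⟨0, 1⟩ := by
  ext1 <;> simp [conicDeriv_re, conicDeriv_im, conicX]

theorem conicDeriv_G (a b : F) :
    conicDeriv a b (conicG a b) = conicG a b * ⟨C a * X ^ 2 - C b, 1⟩ := by
  ext1
  · rw [conicDeriv_re, QuadraticAlgebra.re_mul]
    simp [conicG, conicQuartic]
    ring
  · simp [conicDeriv_im, conicG]
    ring

theorem conicDeriv_pow {a b : F} {e t : ConicRing a b} (h : conicDeriv a b e = e * t) (n : ℕ) :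
    conicDeriv a b (e ^ n) = e ^ n * (n * t) := by
  induction n with
  | zero =>
    have := conicDeriv_mul (1 : ConicRing a b) 1
    simp only [mul_one, one_mul, left_eq_add] at this
    simp [this]
  | succ n ih =>
    rw [pow_succ, conicDeriv_mul, ih, h]
    push_cast
    ring

/-- The monomial `X ^ u * G ^ v`. -/
noncomputable def conicMonomial (a b : F) (u v : ℕ) : ConicRing a b :=
  conicX a b ^ u * conicG a b ^ v

theorem conicDeriv_monomial (a b : F) (u v : ℕ) :
    conicDeriv a b (conicMonomial a b u v) = conicMonomial a b u v *
      ⟨C (v : F) * (C a * X ^ 2 - C b), C ((u + v : ℕ) : F)⟩ := by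
  rw [conicMonomial, conicDeriv_mul, conicDeriv_pow (conicDeriv_X a b),
    conicDeriv_pow (conicDeriv_G a b)]
  have : (⟨C (v : F) * (C a * X ^ 2 - C b), C ((u + v : ℕ) : F)⟩ : ConicRing a b) =
      u * ⟨0, 1⟩ + v * ⟨C a * X ^ 2 - C b, 1⟩ := by
    ext1 <;> simp
  rw [this]
  ring

/-- The elements of `ConicRing a b` whose two components have degree at most `n`. -/
def conicDegLE (a b : F) (n : ℕ) : Submodule F (ConicRing a b) where
  carrier := {z | z.re.natDegree ≤ n ∧ z.im.natDegree ≤ n}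
  add_mem' h k := ⟨natDegree_add_le_of_degree_le h.1 k.1, natDegree_add_le_of_degree_le h.2 k.2⟩
  zero_mem' := by simp
  smul_mem' c _ h := ⟨(natDegree_smul_le c _).trans h.1, (natDegree_smul_le c _).trans h.2⟩

theorem conicDegLE_mono {a b : F} {m n : ℕ} (h : m ≤ n) : conicDegLE a b m ≤ conicDegLE a b n :=
  fun _ hz => ⟨hz.1.trans h, hz.2.trans h⟩

theorem natDegree_conicQuartic_le (a b : F) : (conicQuartic a b).natDegree ≤ 4 := by
  unfold conicQuartic
  compute_degree

theorem mul_mem_conicDegLE {a b : F} {m n : ℕ} {z w : ConicRing a b}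
    (hz : z ∈ conicDegLE a b m) (hw : w ∈ conicDegLE a b n) :
    z * w ∈ conicDegLE a b (m + n + 4) := by
  obtain ⟨z1, z2⟩ := hz
  obtain ⟨w1, w2⟩ := hw
  have hq := natDegree_conicQuartic_le a b
  refine ⟨?_, ?_⟩
  · rw [QuadraticAlgebra.re_mul]
    refine natDegree_add_le_of_degree_le (natDegree_mul_le.trans (by omega)) ?_
    refine natDegree_mul_le.trans ?_
    have := natDegree_mul_le (p := conicQuartic a b) (q := z.im)
    omega
  · rw [QuadraticAlgebra.im_mul]
    refine natDegree_add_le_of_degree_le (natDegree_add_le_of_degree_le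
      (natDegree_mul_le.trans (by omega)) (natDegree_mul_le.trans (by omega))) (by simp)

theorem pow_mem_conicDegLE {a b : F} {m : ℕ} {z : ConicRing a b}
    (hz : z ∈ conicDegLE a b m) (n : ℕ) : z ^ n ∈ conicDegLE a b (n * (m + 4)) := by
  induction n with
  | zero =>
    rw [pow_zero]
    exact ⟨by rw [QuadraticAlgebra.re_one]; simp, by rw [QuadraticAlgebra.im_one]; simp⟩
  | succ n ih =>
    rw [pow_succ]
    exact conicDegLE_mono (by ring_nf; omega) (mul_mem_conicDegLE ih hz)

theorem natDegree_X_mul_derivative_le (f : F[X]) : (X * derivative f).natDegree ≤ f.natDegree := by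
  by_cases h : f.natDegree = 0
  · rw [natDegree_eq_zero] at h
    obtain ⟨c, rfl⟩ := h
    simp
  · have := natDegree_derivative_lt h
    have := natDegree_mul_le (p := X) (q := derivative f)
    have := natDegree_X_le (R := F)
    omega

theorem conicTwist_mem_conicDegLE {a b α β : F} {n : ℕ} {z : ConicRing a b}
    (hz : z ∈ conicDegLE a b n) : conicTwist a b α β z ∈ conicDegLE a b (n + 4) := by
  obtain ⟨z1, z2⟩ := hz
  have hq := natDegree_conicQuartic_le a b
  rw [conicTwist_apply]
  refine Submodule.add_mem _ ⟨?_, ?_⟩ ⟨?_, ?_⟩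
  · rw [conicDeriv_re, mul_comm X, mul_assoc]
    refine natDegree_add_le_of_degree_le (natDegree_mul_le.trans ?_) (natDegree_mul_le.trans ?_)
    · have := natDegree_X_mul_derivative_le z.im
      omega
    · have : (2 * C a * X ^ 2 * (C a * X ^ 2 + C b) - 4 * X ^ 2 : F[X]).natDegree ≤ 4 := by
        compute_degree
      omega
  · rw [conicDeriv_im]
    have := natDegree_X_mul_derivative_le z.re
    omega
  · rw [QuadraticAlgebra.re_mul]
    have h1 : (C β * (C a * X ^ 2 - C b) : F[X]).natDegree ≤ 2 := by compute_degree
    have h2 : (conicQuartic a b * C α).natDegree ≤ 4 := by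
      refine natDegree_mul_le.trans ?_
      rw [natDegree_C]
      omega
    exact natDegree_add_le_of_degree_le (natDegree_mul_le.trans (by dsimp only; omega))
      (natDegree_mul_le.trans (by dsimp only; omega))
  · rw [QuadraticAlgebra.im_mul]
    have h1 : (C β * (C a * X ^ 2 - C b) : F[X]).natDegree ≤ 2 := by compute_degree
    have h2 : (C α : F[X]).natDegree = 0 := natDegree_C _
    refine natDegree_add_le_of_degree_le (natDegree_add_le_of_degree_le
      (natDegree_mul_le.trans (by dsimp only; omega))
      (natDegree_mul_le.trans (by dsimp only; omega))) (by simp)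

theorem conicTwist_pow_mem_conicDegLE {a b α β : F} {n : ℕ} {z : ConicRing a b}
    (hz : z ∈ conicDegLE a b n) (k : ℕ) :
    (conicTwist a b α β ^ k) z ∈ conicDegLE a b (n + 4 * k) := by
  induction k with
  | zero => simpa using hz
  | succ k ih =>
    rw [pow_succ', Module.End.mul_apply]
    exact conicTwist_mem_conicDegLE ih

theorem finrank_degreeLT (n : ℕ) : Module.finrank F (degreeLT F n) = n := by
  rw [(degreeLTEquiv F n).finrank_eq]
  simp

theorem exists_conicTwist_pow_sum_eq_zero {a b : F} {ι : Type*} [Fintype ι] (α β : ι → F)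
    (A m : ℕ) (h : m * (2 * (A + 4 * m)) < Fintype.card ι * A) :
    ∃ c : ι → F[X], c ≠ 0 ∧ (∀ k, c k ∈ degreeLT F A) ∧
      ∀ n < m, ∑ k, (conicTwist a b (α k) (β k) ^ n) ⟨c k, 0⟩ = 0 := by
  classical
  let emb : F[X] →ₗ[F] ConicRing a b :=
    { toFun := fun f => ⟨f, 0⟩
      map_add' := by intro x y; ext1 <;> simp
      map_smul' := by intro r x; ext1 <;> simp }
  let reL : ConicRing a b →ₗ[F] F[X] :=
    { toFun := fun z => z.re, map_add' := by intros; rfl, map_smul' := by intros; rfl }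
  let imL : ConicRing a b →ₗ[F] F[X] :=
    { toFun := fun z => z.im, map_add' := by intros; rfl, map_smul' := by intros; rfl }
  let φ (n : ℕ) : (ι → degreeLT F A) →ₗ[F] ConicRing a b :=
    ∑ k, (conicTwist a b (α k) (β k) ^ n) ∘ₗ emb ∘ₗ (degreeLT F A).subtype ∘ₗ LinearMap.proj k
  have hφ (n : ℕ) (c : ι → degreeLT F A) :
      φ n c = ∑ k, (conicTwist a b (α k) (β k) ^ n) ⟨c k, 0⟩ := by
    simp [φ, emb]
  have hmem (n : Fin m) (c : ι → degreeLT F A) :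
      (φ n c).re ∈ degreeLT F (A + 4 * m) ∧ (φ n c).im ∈ degreeLT F (A + 4 * m) := by
    have : φ n c ∈ conicDegLE a b (A + 4 * n) := by
      rw [hφ]
      refine Submodule.sum_mem _ fun k _ => conicTwist_pow_mem_conicDegLE ⟨?_, by simp⟩ _
      have := (c k).2
      rw [mem_degreeLT] at this
      exact natDegree_le_of_degree_le this.le
    have hn := n.2
    rw [mem_degreeLT, mem_degreeLT]
    constructor
    · refine lt_of_le_of_lt (degree_le_natDegree) ?_
      have := this.1
      exact_mod_cast (by omega : (φ n c).re.natDegree < A + 4 * m)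
    · refine lt_of_le_of_lt (degree_le_natDegree) ?_
      have := this.2
      exact_mod_cast (by omega : (φ n c).im.natDegree < A + 4 * m)
  let Φ : (ι → degreeLT F A) →ₗ[F]
      (Fin m → degreeLT F (A + 4 * m) × degreeLT F (A + 4 * m)) :=
    LinearMap.pi fun n => LinearMap.prod
      ((reL ∘ₗ φ n).codRestrict _ fun c => (hmem n c).1)
      ((imL ∘ₗ φ n).codRestrict _ fun c => (hmem n c).2)
  have : FiniteDimensional F (degreeLT F A) := Module.Finite.equiv (degreeLTEquiv F A).symm
  have : FiniteDimensional F (degreeLT F (A + 4 * m)) :=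
    Module.Finite.equiv (degreeLTEquiv F _).symm
  have hker : LinearMap.ker Φ ≠ ⊥ := by
    apply LinearMap.ker_ne_bot_of_finrank_lt
    rw [Module.finrank_pi_fintype, Module.finrank_pi_fintype]
    simp only [Module.finrank_prod, finrank_degreeLT, Finset.sum_const, Finset.card_univ,
      Fintype.card_fin, smul_eq_mul]
    linarith
  obtain ⟨c, hc, hc0⟩ := Submodule.exists_mem_ne_zero_of_ne_bot hker
  refine ⟨fun k => c k, ?_, fun k => (c k).2, fun n hn => ?_⟩
  · intro h0
    apply hc0
    funext k
    exact Subtype.ext (congrFun h0 k)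
  · rw [← hφ]
    have h1 := congrFun (LinearMap.mem_ker.1 hc) ⟨n, hn⟩
    ext1
    · exact congrArg Subtype.val (congrArg Prod.fst h1)
    · exact congrArg Subtype.val (congrArg Prod.snd h1)

/-- Evaluation of functions at a point of the curve. -/
noncomputable def conicEval {a b : F} (h s : F) (hs : s ^ 2 = (conicQuartic a b).eval h) :
    ConicRing a b →+* F where
  toFun z := z.re.eval h + z.im.eval h * s
  map_one' := by rw [QuadraticAlgebra.re_one, QuadraticAlgebra.im_one]; simp
  map_zero' := by simp
  map_add' z w := by simp; ring
  map_mul' z w := by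
    rw [QuadraticAlgebra.re_mul, QuadraticAlgebra.im_mul]
    simp only [eval_add, eval_mul, eval_zero]
    linear_combination (-(z.im.eval h * w.im.eval h)) * hs

theorem conicEval_apply {a b : F} {h s : F} (hs : s ^ 2 = (conicQuartic a b).eval h)
    (z : ConicRing a b) : conicEval h s hs z = z.re.eval h + z.im.eval h * s := rfl

theorem conicEval_iterate_mul_eq_zero {a b : F} (ev : ConicRing a b →+* F) (m : ℕ) :
    ∀ (x w : ConicRing a b), (∀ n < m, ev ((conicDeriv a b)^[n] x) = 0) →
      ∀ n < m, ev ((conicDeriv a b)^[n] (w * x)) = 0 := by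
  induction m with
  | zero => intro x w _ n hn; omega
  | succ m ih =>
    intro x w hx n hn
    cases n with
    | zero => simpa using Or.inr (hx 0 (by omega))
    | succ n =>
      rw [Function.iterate_succ_apply, conicDeriv_mul, iterate_map_add, map_add,
        ih x _ (fun i hi => hx i (by omega)) n (by omega),
        ih (conicDeriv a b x) w (fun i hi => by
          rw [← Function.iterate_succ_apply]; exact hx (i + 1) (by omega)) n (by omega), add_zero]

theorem conicEval_iterate_pow_mul {a b : F} (ev : ConicRing a b →+* F) {x : ConicRing a b}
    (hx : ev x = 0) (r : ℕ) (y : ConicRing a b) :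
    ev ((conicDeriv a b)^[r] (x ^ r * y)) = r.factorial * ev (conicDeriv a b x) ^ r * ev y := by
  induction r generalizing y with
  | zero => simp
  | succ r ih =>
    have h : conicDeriv a b (x ^ (r + 1) * y) =
        x ^ r * ((r + 1 : ℕ) * conicDeriv a b x * y) + x ^ r * (x * conicDeriv a b y) := by
      have hp : ∀ r : ℕ, conicDeriv a b (x ^ (r + 1)) = (r + 1 : ℕ) * x ^ r * conicDeriv a b x := by
        intro r
        induction r with
        | zero => simp
        | succ r ih => rw [pow_succ, conicDeriv_mul, ih]; push_cast; ring
      rw [conicDeriv_mul, hp]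
      ring
    rw [Function.iterate_succ_apply, h, iterate_map_add, map_add, ih, ih, map_mul, map_mul, map_mul,
      hx, map_natCast, Nat.factorial_succ]
    push_cast
    ring

theorem X_sub_C_pow_dvd_of_conicEval_iterate {a b h s : F} {p : ℕ} [CharP F p]
    (hs : s ^ 2 = (conicQuartic a b).eval h) (hs0 : s ≠ 0) (h0 : h ≠ 0) {f : F[X]} {m : ℕ}
    (hp : p.Prime) (hm : m ≤ p)
    (hf : ∀ n < m, conicEval h s hs ((conicDeriv a b)^[n] ⟨f, 0⟩) = 0) :
    (X - C h) ^ m ∣ f := by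
  suffices H : ∀ r ≤ m, (X - C h) ^ r ∣ f from H m le_rfl
  intro r
  induction r with
  | zero => simp
  | succ r ih =>
    intro hr
    obtain ⟨y, rfl⟩ := ih (by omega)
    have e : (⟨(X - C h) ^ r * y, 0⟩ : ConicRing a b) =
        (algebraMap F[X] (ConicRing a b) (X - C h)) ^ r * algebraMap F[X] (ConicRing a b) y := by
      rw [← map_pow, ← map_mul]
      rfl
    have hev (y : F[X]) : conicEval h s hs (algebraMap F[X] (ConicRing a b) y) = y.eval h := by
      rw [conicEval_apply]
      simp
    have h1 := hf r (by omega)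
    rw [e, conicEval_iterate_pow_mul _ (by simp [hev]), hev] at h1
    have h2 : conicEval h s hs (conicDeriv a b (algebraMap F[X] (ConicRing a b) (X - C h))) =
        h * s := by
      rw [conicEval_apply, conicDeriv_re, conicDeriv_im]
      simp
    have h3 : (r.factorial : F) ≠ 0 := by
      rw [Ne, CharP.cast_eq_zero_iff F p, hp.dvd_factorial]
      omega
    rw [h2] at h1
    have h4 : y.eval h = 0 := by
      simpa [h3, h0, hs0] using h1
    rw [pow_succ]
    exact mul_dvd_mul_left _ (dvd_iff_isRoot.2 h4)

theorem X_sub_C_pow_dvd_norm {a b h s : F} {p : ℕ} [CharP F p]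
    (hs : s ^ 2 = (conicQuartic a b).eval h) (hs0 : s ≠ 0) (h0 : h ≠ 0) {z : ConicRing a b} {m : ℕ}
    (hp : p.Prime) (hm : m ≤ p)
    (hf : ∀ n < m, conicEval h s hs ((conicDeriv a b)^[n] z) = 0) :
    (X - C h) ^ m ∣ QuadraticAlgebra.norm z := by
  refine X_sub_C_pow_dvd_of_conicEval_iterate hs hs0 h0 hp hm ?_
  have : (⟨QuadraticAlgebra.norm z, 0⟩ : ConicRing a b) = star z * z := by
    rw [mul_comm, ← QuadraticAlgebra.algebraMap_norm_eq_mul_star]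
    rfl
  rw [this]
  exact conicEval_iterate_mul_eq_zero _ m _ _ hf

theorem natDegree_norm_le {a b : F} {n : ℕ} {z : ConicRing a b} (hz : z ∈ conicDegLE a b n) :
    (QuadraticAlgebra.norm z).natDegree ≤ 2 * n + 4 := by
  have := (mul_mem_conicDegLE hz (w := star z) (n := n)
    ⟨by simpa using hz.1, by simpa using hz.2⟩).1
  rw [← QuadraticAlgebra.algebraMap_norm_eq_mul_star] at this
  have h2 : (algebraMap F[X] (ConicRing a b) (QuadraticAlgebra.norm z)).re =
    QuadraticAlgebra.norm z := rfl
  rw [h2] at this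
  omega

theorem conicEval_monomial {a b h g : F} (h2 : (2 : F) ≠ 0) (h0 : h ≠ 0) (g0 : g ≠ 0)
    (hg : a * h + b / h = g + 1 / g) :
    ∃ hs : (h * g - h / g) ^ 2 = (conicQuartic a b).eval h,
      ∀ u v : ℕ, conicEval (a := a) (b := b) h (h * g - h / g) hs (conicMonomial a b u v) =
        h ^ u * (h * g) ^ v := by
  have e : a * h ^ 2 + b = h * g + h / g := by
    field_simp at hg ⊢
    linear_combination hg
  have hs : (h * g - h / g) ^ 2 = (conicQuartic a b).eval h := by
    simp only [conicQuartic, eval_sub, eval_pow, eval_add, eval_mul, eval_C, eval_X, eval_ofNat, e]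
    field_simp
    ring
  refine ⟨hs, fun u v => ?_⟩
  rw [conicMonomial, map_mul, map_pow, map_pow, conicEval_apply, conicEval_apply]
  simp only [conicX, conicG, eval_pow, eval_add, eval_mul, eval_C, eval_X, eval_zero, e]
  congr 2
  · ring
  · field_simp
    ring

theorem conicDeriv_iterate_sum {a b : F} {ι : Type*} [Fintype ι] (u v : ι → ℕ) (c : ι → F[X])
    (n : ℕ) : (conicDeriv a b)^[n] (∑ k, conicMonomial a b (u k) (v k) * ⟨c k, 0⟩) =
      ∑ k, conicMonomial a b (u k) (v k) *
        (conicTwist a b ((u k + v k : ℕ) : F) (v k : F) ^ n) ⟨c k, 0⟩ := by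
  rw [← Module.End.coe_pow, map_sum]
  exact Finset.sum_congr rfl fun k _ => conicDeriv_pow_mul _ (conicDeriv_monomial a b _ _) _ _

theorem conicQuartic_ne_zero {a b : F} (hb : b ≠ 0) : conicQuartic a b ≠ 0 := by
  intro h
  have := congrArg (eval 0) h
  simp [conicQuartic, hb] at this

theorem card_le_of_sum_conicMonomial {a b : F} {p : ℕ} [CharP F p] (hp : p.Prime) (h2 : (2 : F) ≠ 0)
    (hb : b ≠ 0) {ι : Type*} [Fintype ι] (u v : ι → ℕ) (c : ι → F[X]) {m D K : ℕ} (hm : m ≤ p)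
    (hc : ∀ n < m, ∑ k, (conicTwist a b ((u k + v k : ℕ) : F) (v k : F) ^ n) ⟨c k, 0⟩ = 0)
    (hz : ∑ k, conicMonomial a b (u k) (v k) * ⟨c k, 0⟩ ∈ conicDegLE a b D)
    (hz0 : QuadraticAlgebra.norm (∑ k, conicMonomial a b (u k) (v k) * ⟨c k, 0⟩) ≠ 0)
    (S : Finset F) (hS : ∀ h ∈ S, h ≠ 0 ∧ ∃ g, g ≠ 0 ∧ a * h + b / h = g + 1 / g ∧
      ∀ k, h ^ u k * (h * g) ^ v k = h ^ K) :
    m * S.card ≤ 2 * D + 4 + 4 * m := by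
  classical
  set z := ∑ k, conicMonomial a b (u k) (v k) * ⟨c k, 0⟩ with hzdef
  set q := conicQuartic a b
  have hq0 : q ≠ 0 := conicQuartic_ne_zero hb
  have hdvd : ∏ h ∈ S with q.eval h ≠ 0, (X - C h) ^ m ∣ QuadraticAlgebra.norm z := by
    refine Finset.prod_dvd_of_coprime ?_ ?_
    · intro x _ y _ hxy
      exact ((pairwise_coprime_X_sub_C Function.injective_id) hxy).pow
    · intro h hh
      obtain ⟨hhS, hqh⟩ := Finset.mem_filter.1 hh
      obtain ⟨h0, g, g0, hg, hk⟩ := hS h hhS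
      obtain ⟨hs, hev⟩ := conicEval_monomial h2 h0 g0 hg
      refine X_sub_C_pow_dvd_norm hs ?_ h0 hp hm ?_
      · intro hs0
        apply hqh
        rw [← hs, hs0]
        simp
      · intro n hn
        rw [hzdef, conicDeriv_iterate_sum, map_sum]
        simp only [map_mul, hev, hk]
        rw [← Finset.mul_sum, ← map_sum, hc n hn]
        simp
  have h1 := natDegree_le_of_dvd hdvd hz0
  rw [natDegree_prod_of_monic _ _ fun i _ => (monic_X_sub_C i).pow m] at h1
  simp only [natDegree_pow, natDegree_X_sub_C, mul_one, Finset.sum_const, smul_eq_mul] at h1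
  have h3 := natDegree_norm_le hz
  have h4 : (S.filter fun h => ¬ q.eval h ≠ 0).card ≤ 4 := by
    calc _ ≤ q.roots.toFinset.card := by
          apply Finset.card_le_card
          intro h hh
          simp only [Finset.mem_filter, not_not] at hh
          simp [hq0, hh.2]
      _ ≤ q.roots.card := Multiset.toFinset_card_le _
      _ ≤ q.natDegree := card_roots' q
      _ ≤ 4 := natDegree_conicQuartic_le a b
  rw [← Finset.card_filter_add_card_filter_not (fun h => q.eval h ≠ 0)]
  rw [mul_add]
  have := Nat.mul_le_mul_left m h4
  linarith

theorem squarefree_conicQuartic {a b : F} (h2 : (2 : F) ≠ 0) (hb : b ≠ 0)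
    (hab : a * b ≠ 1) : Squarefree (conicQuartic a b) := by
  have h4 : (4 : F) ≠ 0 := by
    rw [show (4 : F) = 2 * 2 by norm_num]
    exact mul_ne_zero h2 h2
  have key (e : F) (he : e ^ 2 = 4) : (C a * X ^ 2 + C e * X + C b : F[X]).Separable := by
    have h1 : (4 * (a * b) - 4 : F) ≠ 0 := by
      rw [show (4 * (a * b) - 4 : F) = 4 * (a * b - 1) by ring]
      exact mul_ne_zero h4 (sub_ne_zero.2 hab)
    have hC : (C (4 * (a * b) - 4)⁻¹ : F[X]) * (4 * (C a * C b) - 4) = 1 := by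
      have := congrArg C (inv_mul_cancel₀ h1)
      simpa [show (C 4 : F[X]) = 4 from rfl] using this
    have he' : (C e : F[X]) ^ 2 = 4 := by rw [← C_pow, he]; rfl
    refine ⟨C (4 * (a * b) - 4)⁻¹ * (4 * C a), -C (4 * (a * b) - 4)⁻¹ * (2 * C a * X + C e), ?_⟩
    simp only [derivative_add, derivative_mul, derivative_C, derivative_X_pow, derivative_X]
    simp [show (C 2 : F[X]) = 2 from rfl]
    linear_combination hC - C (4 * (a * b) - 4)⁻¹ * he'
  have hq : conicQuartic a b =
      (C a * X ^ 2 + C (-2) * X + C b) * (C a * X ^ 2 + C 2 * X + C b) := by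
    simp [conicQuartic, show (C 2 : F[X]) = 2 from rfl]
    ring
  rw [hq]
  refine (Separable.mul (key _ (by norm_num)) (key _ (by norm_num)) ?_).squarefree
  have hC : (C (4 * b)⁻¹ : F[X]) * (4 * C b) = 1 := by
    have := congrArg C (inv_mul_cancel₀ (mul_ne_zero h4 hb))
    simpa [show (C 4 : F[X]) = 4 from rfl] using this
  refine ⟨C (4 * b)⁻¹ * (4 + (C a * X - 2)), - C (4 * b)⁻¹ * (C a * X - 2), ?_⟩
  simp [show (C 2 : F[X]) = 2 from rfl] at hC ⊢
  linear_combination hC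

theorem eq_zero_of_sq_eq_mul_sq {q : F[X]} (hq : Squarefree q) (hu : 0 < q.natDegree) (n : ℕ) :
    ∀ x y : F[X], y.natDegree ≤ n → x ^ 2 = q * y ^ 2 → y = 0 := by
  have hq0 : q ≠ 0 := by rintro rfl; simp at hu
  induction n using Nat.strong_induction_on with
  | _ n ih =>
    intro x y hy h
    by_contra hy0
    have h1 : q ∣ x := (hq.dvd_pow_iff_dvd two_ne_zero).1 ⟨_, h⟩
    obtain ⟨x, rfl⟩ := h1
    have h2 : y ^ 2 = q * x ^ 2 := by
      apply mul_left_cancel₀ hq0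
      linear_combination -h
    have h3 : q ∣ y := (hq.dvd_pow_iff_dvd two_ne_zero).1 ⟨_, h2⟩
    obtain ⟨y, rfl⟩ := h3
    have hy1 : y ≠ 0 := by rintro rfl; simp at hy0
    rw [natDegree_mul hq0 hy1] at hy
    refine hy1 (ih y.natDegree (by omega) x y le_rfl ?_)
    apply mul_left_cancel₀ hq0
    linear_combination -h2

theorem eq_zero_of_norm_eq_zero {a b : F} (h2 : (2 : F) ≠ 0) (ha : a ≠ 0) (hb : b ≠ 0)
    (hab : a * b ≠ 1) {z : ConicRing a b} (hz : QuadraticAlgebra.norm z = 0) : z = 0 := by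
  rw [QuadraticAlgebra.norm_def] at hz
  have hdeg : 0 < (conicQuartic a b).natDegree := by
    have : (conicQuartic a b).coeff 4 = a ^ 2 := by
      have e : conicQuartic a b = C (a ^ 2) * X ^ 4 + C (2 * a * b - 4) * X ^ 2 + C (b ^ 2) := by
        simp [conicQuartic, show (C 2 : F[X]) = 2 from rfl, show (C 4 : F[X]) = 4 from rfl]
        ring
      rw [e, coeff_add, coeff_add, coeff_C_mul, coeff_C_mul, coeff_X_pow, coeff_X_pow, coeff_C]
      simp
    have h := le_natDegree_of_ne_zero (p := conicQuartic a b) (n := 4)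
      (by rw [this]; simpa using ha)
    omega
  have him : z.im = 0 := by
    refine eq_zero_of_sq_eq_mul_sq (squarefree_conicQuartic h2 hb hab) hdeg _ z.re z.im le_rfl ?_
    linear_combination hz
  have hre : z.re = 0 := by
    rw [him] at hz
    simpa using hz
  ext1 <;> simp [him, hre]

theorem exists_powerSeries_sq_eq_conicQuartic {a b : F} (h2 : (2 : F) ≠ 0) (hb : b ≠ 0) :
    ∃ σ : PowerSeries F, σ ^ 2 = (conicQuartic a b : F[X]) ∧ PowerSeries.constantCoeff σ = b := by
  have hH : HenselianRing (PowerSeries F) (Ideal.span {PowerSeries.X}) := inferInstance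
  have hc : PowerSeries.constantCoeff ((conicQuartic a b : F[X]) : PowerSeries F) = b ^ 2 := by
    rw [← PowerSeries.coeff_zero_eq_constantCoeff_apply, Polynomial.coeff_coe,
      coeff_zero_eq_eval_zero]
    simp [conicQuartic]
  obtain ⟨σ, h1, h3⟩ := hH.is_henselian
    (X ^ 2 - C ((conicQuartic a b : F[X]) : PowerSeries F)) (by monicity!)
    (PowerSeries.C b) (by
      rw [Ideal.mem_span_singleton, PowerSeries.X_dvd_iff]
      simp [hc]) (by
      have : IsUnit (eval (PowerSeries.C b)
          (derivative (X ^ 2 - C ((conicQuartic a b : F[X]) : PowerSeries F)))) := by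
        rw [PowerSeries.isUnit_iff_constantCoeff]
        have h := map_ofNat (PowerSeries.constantCoeff (R := F)) 2
        simpa [one_add_one_eq_two, hb, h] using h2
      exact this.map _)
  refine ⟨σ, ?_, ?_⟩
  · simpa [sub_eq_zero] using h1
  · rw [Ideal.mem_span_singleton, PowerSeries.X_dvd_iff] at h3
    simpa [sub_eq_zero] using h3

/-- Expansion of functions as power series in `X` at a point of the curve. -/
noncomputable def conicExpand {a b : F} (σ : PowerSeries F)
    (hσ : σ ^ 2 = (conicQuartic a b : F[X])) : ConicRing a b →+* PowerSeries F where
  toFun z := (z.re : PowerSeries F) + z.im * σ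
  map_one' := by rw [QuadraticAlgebra.re_one, QuadraticAlgebra.im_one]; simp
  map_zero' := by simp
  map_add' z w := by simp; ring
  map_mul' z w := by
    rw [QuadraticAlgebra.re_mul, QuadraticAlgebra.im_mul]
    simp only [Polynomial.coe_add, Polynomial.coe_mul, Polynomial.coe_zero]
    linear_combination (-(z.im * w.im : PowerSeries F)) * hσ

theorem conicExpand_apply {a b : F} {σ : PowerSeries F}
    (hσ : σ ^ 2 = (conicQuartic a b : F[X])) (z : ConicRing a b) :
    conicExpand σ hσ z = (z.re : PowerSeries F) + z.im * σ := rfl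

theorem conicExpand_conicDeriv {a b : F} (h2 : (2 : F) ≠ 0) {σ : PowerSeries F}
    (hσ : σ ^ 2 = (conicQuartic a b : F[X])) (z : ConicRing a b) :
    conicExpand σ hσ (conicDeriv a b z) =
      σ * PowerSeries.X * PowerSeries.derivative F (conicExpand σ hσ z) := by
  have h2' : (2 : PowerSeries F) ≠ 0 := by
    intro h
    apply h2
    rw [← map_ofNat (PowerSeries.constantCoeff (R := F)) 2, h, map_zero]
  have h3 := congrArg (Polynomial.coeToPowerSeries.ringHom) (X_mul_derivative_conicQuartic a b)
  have h4 : 2 * σ * PowerSeries.derivative F σ = (derivative (conicQuartic a b) : F[X]) := by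
    rw [← PowerSeries.derivative_coe, ← hσ]
    simp [sq, Derivation.leibniz]
    ring
  have h5 : σ * PowerSeries.X * PowerSeries.derivative F σ =
      ((2 * C a * X ^ 2 * (C a * X ^ 2 + C b) - 4 * X ^ 2 : F[X]) : PowerSeries F) := by
    apply mul_left_cancel₀ h2'
    simp only [map_mul, Polynomial.coeToPowerSeries.ringHom_apply] at h3 ⊢
    have h6 : ((2 : F[X]) : PowerSeries F) = 2 :=
      map_ofNat (Polynomial.coeToPowerSeries.ringHom (R := F)) 2
    rw [h6] at h3
    rw [← h3]
    simp only [Polynomial.coe_X]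
    rw [← h4]
    ring
  rw [conicExpand_apply, conicExpand_apply, conicDeriv_re, conicDeriv_im, map_add,
    Derivation.leibniz, PowerSeries.derivative_coe, PowerSeries.derivative_coe]
  simp only [Polynomial.coe_add, Polynomial.coe_mul, Polynomial.coe_X, ← hσ] at h5 ⊢
  rw [← h5]
  simp only [smul_eq_mul]
  ring

theorem conicExpand_conicTwist_pow {a b α β : F} (h2 : (2 : F) ≠ 0) {σ : PowerSeries F}
    (hσ : σ ^ 2 = (conicQuartic a b : F[X])) (hb : PowerSeries.constantCoeff σ = -b)
    (o : ℕ) (γ : F[X]) (n : ℕ) :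
    ∃ w, conicExpand σ hσ ((conicTwist a b α β ^ n) ⟨X ^ o * γ, 0⟩) = PowerSeries.X ^ o * w ∧
      PowerSeries.constantCoeff w = (-b * (o + α + β)) ^ n * γ.coeff 0 := by
  induction n with
  | zero =>
    refine ⟨γ, ?_, ?_⟩
    · simp [conicExpand_apply]
    · rw [← PowerSeries.coeff_zero_eq_constantCoeff_apply, Polynomial.coeff_coe]
      simp
  | succ n ih =>
    obtain ⟨w, h1, h3⟩ := ih
    refine ⟨σ * ((o : PowerSeries F) * w + PowerSeries.X * PowerSeries.derivative F w) +
      (((C β * (C a * X ^ 2 - C b) : F[X]) : PowerSeries F) + PowerSeries.C α * σ) * w, ?_, ?_⟩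
    · rw [pow_succ', Module.End.mul_apply, conicTwist_apply, map_add, map_mul,
        conicExpand_conicDeriv h2, h1, conicExpand_apply hσ ⟨_, _⟩]
      have : PowerSeries.X * PowerSeries.derivative F (PowerSeries.X ^ o * w) =
          PowerSeries.X ^ o *
            ((o : PowerSeries F) * w + PowerSeries.X * PowerSeries.derivative F w) := by
        rw [Derivation.leibniz, Derivation.leibniz_pow]
        cases o with
        | zero => simp
        | succ o =>
          simp only [smul_eq_mul, nsmul_eq_mul, PowerSeries.derivative_X, Nat.add_sub_cancel]
          ring
      simp only [Polynomial.coe_C]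
      linear_combination σ * this
    · rw [map_add, map_mul, map_mul, map_add, map_add, map_mul, map_mul, map_mul, h3, hb,
        ← PowerSeries.coeff_zero_eq_constantCoeff_apply (φ := ((_ : F[X]) : PowerSeries F)),
        Polynomial.coeff_coe, map_natCast]
      simp [mul_coeff_zero]
      ring

theorem det_mem_conicDegLE {a b : F} {n D : ℕ} (M : Matrix (Fin n) (Fin n) (ConicRing a b))
    (hM : ∀ i j, M i j ∈ conicDegLE a b D) : M.det ∈ conicDegLE a b (n * (D + 4)) := by
  rw [Matrix.det_apply]
  refine Submodule.sum_mem _ fun τ _ => ?_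
  have h : ∀ s : Finset (Fin n), ∏ i ∈ s, M (τ i) i ∈ conicDegLE a b (s.card * (D + 4)) := by
    intro s
    classical
    induction s using Finset.induction_on with
    | empty =>
      rw [Finset.prod_empty]
      exact ⟨by rw [QuadraticAlgebra.re_one]; simp, by rw [QuadraticAlgebra.im_one]; simp⟩
    | insert i s hi ih =>
      rw [Finset.prod_insert hi, Finset.card_insert_of_notMem hi]
      exact conicDegLE_mono (by ring_nf; omega) (mul_mem_conicDegLE (hM _ _) ih)
  have h1 := h Finset.univ
  rw [Finset.card_univ, Fintype.card_fin] at h1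
  rcases Int.units_eq_one_or (Equiv.Perm.sign τ) with hs | hs <;> rw [hs]
  · simpa using h1
  · simpa using h1

/-- A family of monomials in which the twisted Wronskian of a cluster does not vanish. -/
theorem det_conicTwist_ne_zero {a b : F} (h2 : (2 : F) ≠ 0) (hb : b ≠ 0) {n : ℕ}
    (α β : Fin n → F) (o : Fin n → ℕ) (γ : Fin n → F[X]) (hγ : ∀ k, (γ k).coeff 0 ≠ 0)
    (hinj : Function.Injective fun k => (o k + α k + β k : F)) :
    (Matrix.of fun i k : Fin n => (conicTwist a b (α k) (β k) ^ (i : ℕ)) ⟨X ^ o k * γ k, 0⟩).det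
      ≠ 0 := by
  obtain ⟨σ, hσ, hσb⟩ := exists_powerSeries_sq_eq_conicQuartic (a := a) h2 hb
  have hσ' : (-σ) ^ 2 = (conicQuartic a b : F[X]) := by rw [neg_sq, hσ]
  choose w hw hw0 using fun (k : Fin n) (i : ℕ) => conicExpand_conicTwist_pow (α := α k) (β := β k)
    h2 hσ' (by rw [map_neg, hσb]) (o k) (γ k) i
  intro h
  have h1 := congrArg (conicExpand (-σ) hσ') h
  rw [map_zero, RingHom.map_det] at h1
  have e : (conicExpand (-σ) hσ').mapMatrix (Matrix.of fun i k : Fin n =>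
      (conicTwist a b (α k) (β k) ^ (i : ℕ)) ⟨X ^ o k * γ k, 0⟩) =
      Matrix.of fun i k => (PowerSeries.X ^ o k : PowerSeries F) *
        (Matrix.of fun (i k : Fin n) => w k i) i k := by
    ext1 i k
    simp [hw]
  rw [e, Matrix.det_mul_row] at h1
  have h3 : (Matrix.of fun (i k : Fin n) => w k i).det = 0 := by
    refine (mul_eq_zero.1 h1).resolve_left ?_
    exact Finset.prod_ne_zero_iff.2 fun k _ => pow_ne_zero _ PowerSeries.X_ne_zero
  have h4 := congrArg PowerSeries.constantCoeff h3
  rw [map_zero, RingHom.map_det] at h4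
  have e2 : (PowerSeries.constantCoeff (R := F)).mapMatrix (Matrix.of fun (i k : Fin n) => w k i) =
      Matrix.of fun i k => (γ k).coeff 0 *
        (Matrix.vandermonde fun k => -b * (o k + α k + β k)).transpose i k := by
    ext1 i k
    simp [hw0, Matrix.vandermonde_apply, mul_comm]
  rw [e2, Matrix.det_mul_row, Matrix.det_transpose] at h4
  rcases mul_eq_zero.1 h4 with h5 | h5
  · obtain ⟨k, -, hk⟩ := Finset.prod_eq_zero_iff.1 h5
    exact hγ k hk
  · refine Matrix.det_vandermonde_ne_zero_iff.2 ?_ h5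
    intro x y hxy
    exact hinj (mul_left_cancel₀ (neg_ne_zero.2 hb) hxy)

theorem exists_gap {ι : Type*} (K : Finset ι) (u : ι → ℕ) {k₀ : ι} (hk₀ : k₀ ∈ K)
    (hmin : ∀ k ∈ K, u k₀ ≤ u k) {N G : ℕ} (hG : 0 < G) (hN : K.card ≤ N) :
    ∃ q, 1 ≤ q ∧ q ≤ N ∧ ∀ k ∈ K, u k < u k₀ + q * G ∨ u k₀ + (q + 1) * G ≤ u k := by
  classical
  have h : (K.image fun k => (u k - u k₀) / G).card < (Finset.range (N + 1)).card := by
    rw [Finset.card_range]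
    exact Nat.lt_succ_of_le (Finset.card_image_le.trans hN)
  obtain ⟨q, hq, hq'⟩ := Finset.exists_mem_notMem_of_card_lt_card h
  rw [Finset.mem_range] at hq
  simp only [Finset.mem_image, not_exists, not_and] at hq'
  refine ⟨q, ?_, by omega, fun k hk => ?_⟩
  · have := hq' k₀ hk₀
    simp at this
    omega
  · have h1 := hq' k hk
    have h3 := hmin k hk
    rcases lt_or_gt_of_ne h1 with h4 | h4
    · left
      rw [Nat.div_lt_iff_lt_mul hG] at h4
      omega
    · right
      have h5 : q + 1 ≤ (u k - u k₀) / G := h4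
      rw [Nat.le_div_iff_mul_le hG] at h5
      omega

theorem conicExpand_conicMonomial {a b : F} (h2 : (2 : F) ≠ 0) (hb : b ≠ 0) {σ : PowerSeries F}
    (hσ : σ ^ 2 = (conicQuartic a b : F[X])) (hσb : PowerSeries.constantCoeff σ = b) (u v : ℕ) :
    ∃ w, IsUnit w ∧ conicExpand σ hσ (conicMonomial a b u v) = PowerSeries.X ^ u * w := by
  refine ⟨conicExpand σ hσ (conicG a b) ^ v, IsUnit.pow _ ?_, ?_⟩
  · rw [PowerSeries.isUnit_iff_constantCoeff, conicExpand_apply, conicG]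
    rw [map_add, map_mul, hσb, ← PowerSeries.coeff_zero_eq_constantCoeff_apply,
      ← PowerSeries.coeff_zero_eq_constantCoeff_apply, Polynomial.coeff_coe, Polynomial.coeff_coe]
    simp only [mul_coeff_zero, coeff_C_zero, coeff_add, coeff_X_pow]
    have : 2⁻¹ * b + 2⁻¹ * b = b := by field_simp; ring
    simpa [this] using hb
  · rw [conicMonomial, map_mul, map_pow, map_pow]
    congr 2
    simp [conicExpand_apply, conicX]

theorem X_pow_dvd_det {R : Type*} [CommRing R] [IsDomain R] {n : ℕ} {x : R} (hx : x ≠ 0)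
    (M : Matrix (Fin n) (Fin n) R) (E : Fin n → R) {e G : ℕ} (k : Fin n) {w : R} (hw : IsUnit w)
    (hk : E k = x ^ e * w) (h : ∀ i, x ^ (e + G) ∣ ∑ j, M i j * E j) : x ^ G ∣ M.det := by
  have h1 : M.det * E k = ∑ i, M.adjugate k i * ∑ j, M i j * E j := by
    have h3 : M.adjugate.mulVec (M.mulVec E) = M.det • E := by
      rw [Matrix.mulVec_mulVec, Matrix.adjugate_mul, Matrix.smul_mulVec, Matrix.one_mulVec]
    have h4 := congrFun h3 k
    simp only [Pi.smul_apply, smul_eq_mul] at h4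
    rw [← h4]
    rfl
  have h5 : x ^ (e + G) ∣ M.det * E k := by
    rw [h1]
    exact Finset.dvd_sum fun i _ => (h i).mul_left _
  rw [hk, pow_add, mul_left_comm] at h5
  have h6 := (mul_dvd_mul_iff_left (pow_ne_zero e hx)).1 h5
  exact hw.dvd_mul_right.1 h6

theorem norm_eq_zero_of_X_pow_dvd {a b : F} {σ : PowerSeries F}
    (hσ : σ ^ 2 = (conicQuartic a b : F[X])) {z : ConicRing a b} {D G : ℕ}
    (hz : z ∈ conicDegLE a b D) (hG : 2 * D + 4 < G)
    (h : PowerSeries.X ^ G ∣ conicExpand σ hσ z) : QuadraticAlgebra.norm z = 0 := by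
  have h1 : PowerSeries.X ^ G ∣ ((QuadraticAlgebra.norm z : F[X]) : PowerSeries F) := by
    have e : ((QuadraticAlgebra.norm z : F[X]) : PowerSeries F) =
        conicExpand σ hσ z * conicExpand σ hσ (star z) := by
      rw [← map_mul, ← QuadraticAlgebra.algebraMap_norm_eq_mul_star, conicExpand_apply]
      simp
    rw [e]
    exact h.mul_right _
  rw [PowerSeries.X_pow_dvd_iff] at h1
  by_contra h0
  have h3 := natDegree_norm_le hz
  have h4 := h1 (QuadraticAlgebra.norm z).natDegree (by omega)
  rw [Polynomial.coeff_coe, coeff_natDegree, leadingCoeff_eq_zero] at h4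
  exact h0 h4

theorem norm_sum_conicMonomial_ne_zero {a b : F} (h2 : (2 : F) ≠ 0) (ha : a ≠ 0) (hb : b ≠ 0)
    (hab : a * b ≠ 1) {ι : Type*} [Fintype ι] (u v : ι → ℕ) (c : ι → F[X]) (hc : c ≠ 0)
    {A N G : ℕ} (hcA : ∀ k, c k ∈ degreeLT F A) (hN : Fintype.card ι ≤ N)
    (hG : 2 * (N * (A + 4 * N + 4)) + 4 < G)
    (hinj : ∀ k k', k ≠ k' → u k < u k' + N * G → u k' < u k + N * G → ∀ o < A, ∀ o' < A,
      ((o + u k + 2 * v k : ℕ) : F) ≠ ((o' + u k' + 2 * v k' : ℕ) : F)) :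
    QuadraticAlgebra.norm (∑ k, conicMonomial a b (u k) (v k) * ⟨c k, 0⟩) ≠ 0 := by
  classical
  intro hnorm
  have hz := eq_zero_of_norm_eq_zero h2 ha hb hab hnorm
  have hrel (n : ℕ) : ∑ k, conicMonomial a b (u k) (v k) *
      (conicTwist a b ((u k + v k : ℕ) : F) (v k : F) ^ n) ⟨c k, 0⟩ = 0 := by
    rw [← conicDeriv_iterate_sum, hz, ← Module.End.coe_pow, map_zero]
  have hdec (k : ι) : ∃ o : ℕ, ∃ γ : F[X], c k ≠ 0 → c k = X ^ o * γ ∧ γ.coeff 0 ≠ 0 ∧ o < A := by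
    by_cases h : c k = 0
    · exact ⟨0, 0, fun h' => absurd h h'⟩
    · obtain ⟨γ, h1, h3⟩ := exists_eq_pow_rootMultiplicity_mul_and_not_dvd (c k) h 0
      rw [C_0, sub_zero] at h1 h3
      refine ⟨_, γ, fun _ => ⟨h1, fun h4 => h3 (X_dvd_iff.2 h4), ?_⟩⟩
      have h5 := hcA k
      rw [mem_degreeLT, ← natDegree_lt_iff_degree_lt h] at h5
      have hγ : γ ≠ 0 := by
        rintro rfl
        simp at h3
      have h6 := congrArg natDegree h1
      rw [natDegree_mul (pow_ne_zero _ X_ne_zero) hγ, natDegree_X_pow] at h6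
      omega
  choose o γ hoγ using hdec
  set K := Finset.univ.filter fun k => c k ≠ 0 with hK
  have hKne : K.Nonempty := by
    obtain ⟨k, hk⟩ := Function.ne_iff.1 hc
    exact ⟨k, by simpa [hK] using hk⟩
  obtain ⟨k₀, hk₀, hmin⟩ := Finset.exists_min_image K u hKne
  obtain ⟨q, hq1, hqN, hgap⟩ := exists_gap K u hk₀ hmin (by omega : 0 < G)
    ((Finset.card_le_univ K).trans hN)
  set S := K.filter fun k => u k < u k₀ + q * G with hS
  have hqG : q * G ≤ N * G := Nat.mul_le_mul_right _ hqN
  have hk₀S : k₀ ∈ S := by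
    rw [hS, Finset.mem_filter]
    refine ⟨hk₀, ?_⟩
    have : 1 * G ≤ q * G := Nat.mul_le_mul_right _ hq1
    omega
  set e := S.equivFin.symm with he
  have heK (i : Fin S.card) : (e i : ι) ∈ K := (Finset.mem_filter.1 (e i).2).1
  have heS (i : Fin S.card) : u (e i) < u k₀ + q * G := (Finset.mem_filter.1 (e i).2).2
  have hec (i : Fin S.card) : c (e i) ≠ 0 := (Finset.mem_filter.1 (heK i)).2
  let M : Matrix (Fin S.card) (Fin S.card) (ConicRing a b) := Matrix.of fun i k =>
    (conicTwist a b ((u (e k) + v (e k) : ℕ) : F) (v (e k) : F) ^ (i : ℕ)) ⟨c (e k), 0⟩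
  have hMdet : M.det ≠ 0 := by
    have h := det_conicTwist_ne_zero (a := a) h2 hb
      (fun k => ((u (e k) + v (e k) : ℕ) : F)) (fun k => (v (e k) : F)) (fun k => o (e k))
      (fun k => γ (e k)) (fun k => (hoγ _ (hec k)).2.1) (by
        intro i j hij
        by_contra hne
        have hne' : (e i : ι) ≠ e j := fun h => hne (e.injective (Subtype.ext h))
        refine hinj _ _ hne' ?_ ?_ _ (hoγ _ (hec i)).2.2 _ (hoγ _ (hec j)).2.2 ?_
        · have := heS i
          have := hmin _ (heK j)
          omega
        · have := heS j
          have := hmin _ (heK i)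
          omega
        · push_cast at hij ⊢
          linear_combination hij)
    have hM : M = Matrix.of fun i k : Fin S.card =>
        (conicTwist a b ((u (e k) + v (e k) : ℕ) : F) (v (e k) : F) ^ (i : ℕ))
          ⟨X ^ o (e k) * γ (e k), 0⟩ := by
      ext1 i k
      simp only [M, Matrix.of_apply, ← (hoγ _ (hec k)).1]
    rw [hM]
    exact h
  have hcard : S.card ≤ N := (Finset.card_le_univ S).trans hN
  have hMdeg : M.det ∈ conicDegLE a b (N * (A + 4 * N + 4)) := by
    refine conicDegLE_mono ?_ (det_mem_conicDegLE (D := A + 4 * N) M fun i k => ?_)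
    · exact Nat.mul_le_mul_right _ hcard
    · refine conicDegLE_mono ?_ (conicTwist_pow_mem_conicDegLE (n := A) ⟨?_, by simp⟩ _)
      · have := i.2
        omega
      · have := hcA (e k)
        rw [mem_degreeLT] at this
        exact natDegree_le_of_degree_le this.le
  obtain ⟨σ, hσ, hσb⟩ := exists_powerSeries_sq_eq_conicQuartic (a := a) h2 hb
  refine hMdet (eq_zero_of_norm_eq_zero h2 ha hb hab
    (norm_eq_zero_of_X_pow_dvd hσ hMdeg hG ?_))
  obtain ⟨w, hw, hw'⟩ := conicExpand_conicMonomial h2 hb hσ hσb (u k₀) (v k₀)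
  rw [RingHom.map_det]
  refine X_pow_dvd_det PowerSeries.X_ne_zero _
    (fun k => conicExpand σ hσ (conicMonomial a b (u (e k)) (v (e k)))) (e.symm ⟨k₀, hk₀S⟩) hw
    (by simpa using hw') fun i => ?_
  have h1 : ∑ j, (conicExpand σ hσ).mapMatrix M i j *
      conicExpand σ hσ (conicMonomial a b (u (e j)) (v (e j))) =
      ∑ k ∈ S, conicExpand σ hσ (conicMonomial a b (u k) (v k) *
        (conicTwist a b ((u k + v k : ℕ) : F) (v k : F) ^ (i : ℕ)) ⟨c k, 0⟩) := by
    rw [← Finset.sum_coe_sort S]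
    refine Fintype.sum_equiv e _ _ fun j => ?_
    rw [map_mul, mul_comm]
    rfl
  have h3 := congrArg (conicExpand σ hσ) (hrel i)
  rw [map_zero, map_sum, ← Finset.sum_add_sum_compl S] at h3
  rw [h1, eq_neg_of_add_eq_zero_left h3, dvd_neg]
  refine Finset.dvd_sum fun k hk => ?_
  by_cases hck : c k = 0
  · have : (⟨c k, 0⟩ : ConicRing a b) = 0 := by ext1 <;> simp [hck]
    rw [this, map_zero, mul_zero, map_zero]
    exact dvd_zero _
  · have hkK : k ∈ K := by simpa [hK] using hck
    have hkS : ¬ u k < u k₀ + q * G := fun h => by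
      rw [Finset.mem_compl] at hk
      exact hk (Finset.mem_filter.2 ⟨hkK, h⟩)
    obtain ⟨w', -, hw''⟩ := conicExpand_conicMonomial h2 hb hσ hσb (u k) (v k)
    rw [map_mul, hw'', mul_assoc]
    refine (pow_dvd_pow _ ?_).mul_right _
    have h5 := (hgap k hkK).resolve_left hkS
    have : 1 * G ≤ q * G := Nat.mul_le_mul_right _ hq1
    rw [add_mul] at h5
    omega

theorem conicMonomial_mem_conicDegLE (a b : F) (u v : ℕ) :
    conicMonomial a b u v ∈ conicDegLE a b (u + 6 * v + 4) := by
  have hX : conicX a b ^ u ∈ conicDegLE a b u := by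
    have h : conicX a b ^ u = ⟨X ^ u, 0⟩ := (map_pow (algebraMap F[X] (ConicRing a b)) X u).symm
    rw [h]
    exact ⟨by simp, by simp⟩
  have hG : conicG a b ∈ conicDegLE a b 2 := by
    refine ⟨?_, ?_⟩
    · simp only [conicG]
      compute_degree
    · simp [conicG]
  exact conicDegLE_mono (by omega) (mul_mem_conicDegLE hX (pow_mem_conicDegLE hG v))

/-- **Stepanov's method** for the equation `a h + b / h = g + 1 / g` in roots of unity. -/
theorem mul_card_le_of_rootsOfUnity {a b : F} {p : ℕ} [CharP F p] (hp : p.Prime) (h2 : (2 : F) ≠ 0)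
    (ha : a ≠ 0) (hb : b ≠ 0) (hab : a * b ≠ 1) {k ℓ d : ℕ} (hk : 1 ≤ k)
    (hkℓ : 36800 * k ^ 6 ≤ ℓ) (hkd : 36800 * k ^ 6 ≤ d) (hlt : k ^ 2 + 8 * k * (ℓ + d) ≤ p)
    (S : Finset F) (hS : ∀ h ∈ S, h ^ ℓ = 1 ∧ ∃ g, g ^ d = 1 ∧ a * h + b / h = g + 1 / g) :
    k * S.card ≤ 100 * (ℓ + d) := by
  let u (x : Fin (4 * k) × Fin (4 * k)) : ℕ := ℓ * x.1 + d * (4 * k - x.2)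
  let v (x : Fin (4 * k) × Fin (4 * k)) : ℕ := d * x.2
  have hcard : Fintype.card (Fin (4 * k) × Fin (4 * k)) = 16 * k ^ 2 := by
    simp
    ring
  have hk2 : k ^ 2 ≤ k ^ 4 := Nat.pow_le_pow_right hk (by norm_num)
  have hk6 : k ^ 2 ≤ k ^ 6 := Nat.pow_le_pow_right hk (by norm_num)
  have hk4 : 1 ≤ k ^ 4 := Nat.one_le_pow _ _ hk
  have hk2' : 1 ≤ k ^ 2 := Nat.one_le_pow _ _ hk
  have hℓ0 : 0 < ℓ := by omega
  have hd0 : 0 < d := by omega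
  have hu (x : Fin (4 * k) × Fin (4 * k)) : u x + v x = ℓ * x.1 + d * (4 * k) := by
    have h1 := x.2.2
    have h3 : (x.2 : ℕ) + (4 * k - x.2) = 4 * k := by omega
    have h4 : d * (x.2 : ℕ) + d * (4 * k - x.2) = d * (4 * k) := by rw [← mul_add, h3]
    simp only [u, v]
    omega
  have hv (x : Fin (4 * k) × Fin (4 * k)) : v x ≤ d * (4 * k) :=
    Nat.mul_le_mul_left _ x.2.2.le
  have hi (x : Fin (4 * k) × Fin (4 * k)) : ℓ * (x.1 : ℕ) ≤ ℓ * (4 * k) :=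
    Nat.mul_le_mul_left _ x.1.2.le
  obtain ⟨c, hc0, hcA, hc⟩ := exists_conicTwist_pow_sum_eq_zero (a := a) (b := b)
    (fun x => ((u x + v x : ℕ) : F)) (fun x => (v x : F)) (k ^ 2) (k ^ 2) (by
      rw [hcard]
      have : k ^ 2 * k ^ 2 = k ^ 4 := by ring
      calc k ^ 2 * (2 * (k ^ 2 + 4 * k ^ 2)) = 10 * k ^ 4 := by ring
        _ < 16 * k ^ 4 := by omega
        _ = 16 * k ^ 2 * k ^ 2 := by ring)
  have hbound (o : ℕ) (ho : o < k ^ 2) (x) : o + u x + 2 * v x < p := by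
    have h1 := hu x
    have h3 := hv x
    have h4 := hi x
    have : k ^ 2 + 8 * k * (ℓ + d) = k ^ 2 + 2 * (ℓ * (4 * k)) + 2 * (d * (4 * k)) := by ring
    omega
  have hne := norm_sum_conicMonomial_ne_zero h2 ha hb hab u v c hc0 (A := k ^ 2) (N := 16 * k ^ 2)
    (G := 2300 * k ^ 4) hcA hcard.le (by
      calc 2 * (16 * k ^ 2 * (k ^ 2 + 4 * (16 * k ^ 2) + 4)) + 4 =
            2080 * k ^ 4 + 128 * k ^ 2 + 4 := by ring
        _ < 2300 * k ^ 4 := by omega) (by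
      intro x y hxy h1 h3 o ho o' ho' heq
      have hW : 16 * k ^ 2 * (2300 * k ^ 4) = 36800 * k ^ 6 := by ring
      rw [hW] at h1 h3
      have heq' : o + u x + 2 * v x = o' + u y + 2 * v y := by
        have h4 := (CharP.cast_eq_iff_mod_eq F p).1 heq
        exact Nat.ModEq.eq_of_lt_of_lt h4 (hbound o ho x) (hbound o' ho' y)
      have hux := hu x
      have huy := hu y
      have hx1 : (x.1 : ℕ) = y.1 := by
        rcases lt_trichotomy (x.1 : ℕ) y.1 with h | h | h
        · have : ℓ * ((x.1 : ℕ) + 1) ≤ ℓ * y.1 := Nat.mul_le_mul_left _ h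
          rw [mul_add] at this
          omega
        · exact h
        · have : ℓ * ((y.1 : ℕ) + 1) ≤ ℓ * x.1 := Nat.mul_le_mul_left _ h
          rw [mul_add] at this
          omega
      have hx2 : (x.2 : ℕ) = y.2 := by
        rw [hx1] at hux
        rcases lt_trichotomy (x.2 : ℕ) y.2 with h | h | h
        · have : d * ((x.2 : ℕ) + 1) ≤ d * y.2 := Nat.mul_le_mul_left _ h
          rw [mul_add] at this
          simp only [v] at *
          omega
        · exact h
        · have : d * ((y.2 : ℕ) + 1) ≤ d * x.2 := Nat.mul_le_mul_left _ h
          rw [mul_add] at this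
          simp only [v] at *
          omega
      exact hxy (Prod.ext (Fin.ext hx1) (Fin.ext hx2)))
  have hdeg : ∑ x, conicMonomial a b (u x) (v x) * ⟨c x, 0⟩ ∈
      conicDegLE a b (4 * k * ℓ + 28 * k * d + 8 + k ^ 2) := by
    refine Submodule.sum_mem _ fun x _ => conicDegLE_mono ?_ (mul_mem_conicDegLE (n := k ^ 2)
      (conicMonomial_mem_conicDegLE a b (u x) (v x)) ⟨?_, by simp⟩)
    · have h1 := hu x
      have h3 := hv x
      have h4 := hi x
      have : 4 * k * ℓ + 28 * k * d + 8 + k ^ 2 =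
        ℓ * (4 * k) + 7 * (d * (4 * k)) + 8 + k ^ 2 := by ring
      omega
    · have := hcA x
      rw [mem_degreeLT] at this
      exact natDegree_le_of_degree_le this.le
  have hmain := card_le_of_sum_conicMonomial hp h2 hb u v c (m := k ^ 2) (K := 4 * k * d)
    (by omega) hc hdeg hne S (by
      intro h hh
      obtain ⟨h1, g, hg, hgeq⟩ := hS h hh
      have hh0 : h ≠ 0 := by
        rintro rfl
        rw [zero_pow hℓ0.ne'] at h1
        exact zero_ne_one h1
      have hg0 : g ≠ 0 := by
        rintro rfl
        rw [zero_pow hd0.ne'] at hg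
        exact zero_ne_one hg
      refine ⟨hh0, g, hg0, hgeq, fun x => ?_⟩
      rw [mul_pow, ← mul_assoc, ← pow_add, hu x, pow_add, pow_mul, h1, one_pow, one_mul]
      simp only [v]
      rw [pow_mul g, hg, one_pow, mul_one]
      congr 1
      ring)
  have h5 : 20 + 6 * k ^ 2 ≤ k * d := by
    have : 1 * d ≤ k * d := Nat.mul_le_mul_right _ hk
    omega
  have h6 : k * (k * S.card) ≤ k * (100 * (ℓ + d)) := by
    have e1 : k * (k * S.card) = k ^ 2 * S.card := by ring
    have e2 : k * (100 * (ℓ + d)) = 100 * (k * ℓ) + 100 * (k * d) := by ring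
    have e3 : 2 * (4 * k * ℓ + 28 * k * d + 8 + k ^ 2) + 4 + 4 * k ^ 2 =
      8 * (k * ℓ) + 56 * (k * d) + 20 + 6 * k ^ 2 := by ring
    omega
  exact Nat.le_of_mul_le_mul_left h6 hk

end Quartic

section Cyclotomic

open Polynomial NumberField

theorem le_totient_mul_card_divisors (n : ℕ) : n ≤ n.totient * n.divisors.card := by
  rcases Nat.eq_zero_or_pos n with rfl | hn
  · simp
  calc n = ∑ d ∈ n.divisors, d.totient := (Nat.sum_totient n).symm
    _ ≤ ∑ d ∈ n.divisors, n.totient := by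
      refine Finset.sum_le_sum fun d hd => ?_
      exact Nat.le_of_dvd (Nat.totient_pos.2 hn)
        (Nat.totient_dvd_of_dvd (Nat.dvd_of_mem_divisors hd))
    _ = _ := by rw [Finset.sum_const, smul_eq_mul, mul_comm]

theorem two_pow_card_primeFactors_le {n : ℕ} (hn : n ≠ 0) : 2 ^ n.primeFactors.card ≤ n := by
  calc 2 ^ n.primeFactors.card = ∏ q ∈ n.primeFactors, 2 := by rw [Finset.prod_const]
    _ ≤ ∏ q ∈ n.primeFactors, q :=
      Finset.prod_le_prod' fun q hq => (Nat.prime_of_mem_primeFactors hq).two_le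
    _ ≤ n := Nat.le_of_dvd (Nat.pos_of_ne_zero hn) (Nat.prod_primeFactors_dvd n)

/-- The Markoff form evaluated at three traces of powers of an `n`-th root of unity. -/
def cyclotomicMarkoff {R : Type*} [CommRing R] (n : ℕ) (z : R) (a : Fin 3 → ℕ) : R :=
  (∑ i, (z ^ a i + (z ^ a i) ^ (n - 1)) ^ 2) - ∏ i, (z ^ a i + (z ^ a i) ^ (n - 1))

theorem map_cyclotomicMarkoff {R S : Type*} [CommRing R] [CommRing S] (f : R →+* S) (n : ℕ) (z : R)
    (a : Fin 3 → ℕ) : f (cyclotomicMarkoff n z a) = cyclotomicMarkoff n (f z) a := by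
  simp [cyclotomicMarkoff]

theorem exists_real_trace {n : ℕ} (hn : n ≠ 0) {z : ℂ} (hz : z ^ n = 1) :
    ∃ x : ℝ, |x| ≤ 2 ∧ z + z ^ (n - 1) = x := by
  have hnorm := Complex.norm_eq_one_of_pow_eq_one hz hn
  have h : z ^ (n - 1) = (starRingEnd ℂ) z := by
    have h0 : z ≠ 0 := by
      rintro rfl
      simp at hnorm
    apply mul_left_cancel₀ h0
    rw [← pow_succ', Nat.sub_add_cancel (Nat.one_le_iff_ne_zero.2 hn), hz, Complex.mul_conj,
      Complex.normSq_eq_norm_sq, hnorm]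
    simp
  refine ⟨2 * z.re, ?_, ?_⟩
  · rw [abs_mul, abs_two]
    have := Complex.abs_re_le_norm z
    linarith
  · rw [h, Complex.add_conj]

theorem norm_cyclotomicMarkoff_le {n : ℕ} (hn : n ≠ 0) {z : ℂ} (hz : z ^ n = 1) (a : Fin 3 → ℕ) :
    ‖cyclotomicMarkoff n z a‖ ≤ 20 := by
  have h (i : Fin 3) : ‖z ^ a i + (z ^ a i) ^ (n - 1)‖ ≤ 2 := by
    obtain ⟨x, hx, hx'⟩ := exists_real_trace hn (z := z ^ a i)
      (by rw [← pow_mul, mul_comm, pow_mul, hz, one_pow])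
    rw [hx', Complex.norm_real]
    exact hx
  rw [cyclotomicMarkoff]
  refine (norm_sub_le _ _).trans ?_
  have h1 : ‖∑ i, (z ^ a i + (z ^ a i) ^ (n - 1)) ^ 2‖ ≤ ∑ i : Fin 3, (2 : ℝ) ^ 2 :=
    norm_sum_le_of_le _ fun i _ => by
      rw [norm_pow]
      exact pow_le_pow_left₀ (norm_nonneg _) (h i) 2
  have h2 : ‖∏ i, (z ^ a i + (z ^ a i) ^ (n - 1))‖ ≤ ∏ i : Fin 3, (2 : ℝ) := by
    rw [norm_prod]
    exact Finset.prod_le_prod (fun _ _ => norm_nonneg _) fun i _ => h i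
  simp only [Finset.sum_const, Finset.prod_const, Finset.card_univ, Fintype.card_fin,
    nsmul_eq_mul] at h1 h2
  refine (add_le_add h1 h2).trans ?_
  norm_num

theorem trace_eq_zero_of_cyclotomicMarkoff_eq_zero {n : ℕ} (hn : n ≠ 0) {z : ℂ} (hz : z ^ n = 1)
    {a : Fin 3 → ℕ} (h : cyclotomicMarkoff n z a = 0) (i : Fin 3) :
    z ^ a i + (z ^ a i) ^ (n - 1) = 0 := by
  choose x hx hx' using fun i => exists_real_trace hn (z := z ^ a i)
    (by rw [← pow_mul, mul_comm, pow_mul, hz, one_pow])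
  simp only [cyclotomicMarkoff, hx', Fin.sum_univ_three, Fin.prod_univ_three] at h
  have h1 : x 0 ^ 2 + x 1 ^ 2 + x 2 ^ 2 - x 0 * x 1 * x 2 = 0 := by exact_mod_cast h
  have key (u v w : ℝ) (hu : |u| ≤ 2) (huvw : u ^ 2 + v ^ 2 + w ^ 2 - u * v * w = 0) : u = 0 := by
    rw [abs_le] at hu
    have : u ^ 2 ≤ 0 := by
      nlinarith [mul_nonneg (by linarith : (0:ℝ) ≤ 2 - u) (sq_nonneg (v + w)),
        mul_nonneg (by linarith : (0:ℝ) ≤ 2 + u) (sq_nonneg (v - w))]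
    nlinarith
  rw [hx']
  have hi : x i = 0 := by
    fin_cases i
    · exact key _ _ _ (hx 0) h1
    · exact key (x 1) (x 2) (x 0) (hx 1) (by linarith)
    · exact key (x 2) (x 0) (x 1) (hx 2) (by linarith)
  rw [hi, Complex.ofReal_zero]

/-- `CyclotomicField n ℚ` is cyclotomic for the canonical `ℚ`-algebra structure. -/
instance isCyclotomicExtension_rat (n : ℕ) [NeZero n] :
    @IsCyclotomicExtension {n} ℚ (CyclotomicField n ℚ) _ _ DivisionRing.toRatAlgebra := by
  have h : @IsCyclotomicExtension {n} ℚ (CyclotomicField n ℚ) _ _ (CyclotomicField.algebra n ℚ) :=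
    CyclotomicField.isCyclotomicExtension n ℚ
  convert h
  exact Subsingleton.elim _ _

/-- The absolute norm of `cyclotomicMarkoff` in the `n`-th cyclotomic field. -/
noncomputable def cyclotomicMarkoffNorm (n : ℕ) [NeZero n] (a : Fin 3 → ℕ) : ℕ :=
  (Algebra.norm ℤ (cyclotomicMarkoff n
    (IsCyclotomicExtension.zeta_spec n ℚ (CyclotomicField n ℚ)).toInteger a)).natAbs

theorem cyclotomicMarkoffNorm_le (n : ℕ) [NeZero n] (a : Fin 3 → ℕ) :
    cyclotomicMarkoffNorm n a ≤ 2 ^ (5 * n) := by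
  set K := CyclotomicField n ℚ
  have hζ := IsCyclotomicExtension.zeta_spec n ℚ K
  set z := hζ.toInteger with hz
  have h1 : ((Algebra.norm ℤ (cyclotomicMarkoff n z a) : ℤ) : ℂ) =
      ∏ φ : K →ₐ[ℚ] ℂ, φ (cyclotomicMarkoff n z a : 𝓞 K) := by
    rw [← Algebra.norm_eq_prod_embeddings, ← Algebra.coe_norm_int]
    simp
  have h2 : (cyclotomicMarkoffNorm n a : ℝ) = ‖∏ φ : K →ₐ[ℚ] ℂ,
      φ (cyclotomicMarkoff n z a : 𝓞 K)‖ := by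
    rw [← h1, Complex.norm_intCast, cyclotomicMarkoffNorm, Nat.cast_natAbs,
      Int.cast_abs]
  have hcard : Fintype.card (K →ₐ[ℚ] ℂ) ≤ n := by
    rw [AlgHom.card, IsCyclotomicExtension.finrank K (cyclotomic.irreducible_rat (NeZero.pos n))]
    exact Nat.totient_le n
  have h3 : (cyclotomicMarkoffNorm n a : ℝ) ≤ 20 ^ n := by
    rw [h2, norm_prod]
    calc _ ≤ ∏ φ : K →ₐ[ℚ] ℂ, (20 : ℝ) := by
          refine Finset.prod_le_prod (fun _ _ => norm_nonneg _) fun φ _ => ?_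
          have e : φ (cyclotomicMarkoff n z a : 𝓞 K) =
              cyclotomicMarkoff n (φ (algebraMap (𝓞 K) K z)) a :=
            map_cyclotomicMarkoff (φ.toRingHom.comp (algebraMap (𝓞 K) K)) n z a
          rw [e]
          refine norm_cyclotomicMarkoff_le (NeZero.ne n) ?_ a
          rw [← map_pow, ← map_pow]
          have : z ^ n = 1 := hζ.toInteger_isPrimitiveRoot.pow_eq_one
          rw [this, map_one, map_one]
      _ = 20 ^ Fintype.card (K →ₐ[ℚ] ℂ) := by rw [Finset.prod_const, Finset.card_univ]
      _ ≤ 20 ^ n := pow_le_pow_right₀ (by norm_num) hcard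
  have h4 : cyclotomicMarkoffNorm n a ≤ 20 ^ n := by exact_mod_cast h3
  refine h4.trans ?_
  rw [pow_mul]
  exact Nat.pow_le_pow_left (by norm_num) n

theorem card_primeFactors_cyclotomicMarkoffNorm_le (n : ℕ) [NeZero n] (a : Fin 3 → ℕ) :
    (cyclotomicMarkoffNorm n a).primeFactors.card ≤ 5 * n := by
  by_cases h : cyclotomicMarkoffNorm n a = 0
  · simp [h]
  · exact (Nat.pow_le_pow_iff_right (by norm_num)).1
      ((two_pow_card_primeFactors_le h).trans (cyclotomicMarkoffNorm_le n a))

theorem mem_primeFactors_cyclotomicMarkoffNorm {F : Type*} [Field F] [IsAlgClosed F] {p : ℕ}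
    (hp : p.Prime) [CharP F p] {n : ℕ} [NeZero n] (hpn : ¬ p ∣ n) {g : Fin 3 → F}
    (hg : ∀ i, g i ^ n = 1)
    (hM : ∑ i, (g i + (g i) ^ (n - 1)) ^ 2 = ∏ i, (g i + (g i) ^ (n - 1)))
    {i₀ : Fin 3} (hi₀ : g i₀ + g i₀ ^ (n - 1) ≠ 0) :
    ∃ a : Fin 3 → Fin n, p ∈ (cyclotomicMarkoffNorm n fun i => a i).primeFactors := by
  have hnF : NeZero (n : F) := ⟨fun h => hpn ((CharP.cast_eq_zero_iff F p n).1 h)⟩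
  obtain ⟨z, hz⟩ := IsAlgClosed.exists_root (cyclotomic n F)
    (degree_cyclotomic_pos n F (NeZero.pos n)).ne'
  have hz' : IsPrimitiveRoot z n := isRoot_cyclotomic_iff.1 hz
  choose a ha ha' using fun i => hz'.eq_pow_of_pow_eq_one (hg i)
  set K := CyclotomicField n ℚ
  have hζ := IsCyclotomicExtension.zeta_spec n ℚ K
  have hmin : aeval z (minpoly ℤ hζ.integralPowerBasis.gen) = 0 := by
    have h0 := minpoly.algebraMap_eq (A := ℤ) (RingOfIntegers.coe_injective (K := K)) hζ.toInteger
    have h1 := cyclotomic_eq_minpoly hζ (NeZero.pos n)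
    have h2 : minpoly ℤ hζ.toInteger = cyclotomic n ℤ := by
      rw [← h0, h1]
      rfl
    rw [hζ.integralPowerBasis_gen, h2, aeval_def, ← eval_map, map_cyclotomic]
    exact hz
  let f : 𝓞 K →ₐ[ℤ] F := hζ.integralPowerBasis.lift z hmin
  have hf : f hζ.toInteger = z := by
    have := hζ.integralPowerBasis.lift_gen z hmin
    rwa [hζ.integralPowerBasis_gen] at this
  refine ⟨fun i => ⟨a i, ha i⟩, ?_⟩
  set α := cyclotomicMarkoff n hζ.toInteger a with hα
  have hfα : f α = 0 := by
    have h1 := map_cyclotomicMarkoff (f : 𝓞 K →+* F) n hζ.toInteger a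
    have h2 : f α = cyclotomicMarkoff n (f hζ.toInteger) a := h1
    rw [h2, hf]
    simp only [cyclotomicMarkoff, ha']
    exact sub_eq_zero.2 hM
  have hα0 : α ≠ 0 := by
    intro h
    have φ : K →ₐ[ℚ] ℂ := IsAlgClosed.lift
    have h3 := map_cyclotomicMarkoff (φ.toRingHom.comp (algebraMap (𝓞 K) K)) n hζ.toInteger a
    rw [← hα, h, map_zero] at h3
    have h4 := trace_eq_zero_of_cyclotomicMarkoff_eq_zero (NeZero.ne n) (by
      rw [← map_pow, hζ.toInteger_isPrimitiveRoot.pow_eq_one, map_one]) h3.symm i₀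
    rw [← map_pow, ← map_pow, ← map_add] at h4
    have h5 := (φ.injective.comp RingOfIntegers.coe_injective) (a₂ := 0)
      (h4.trans (by simp))
    have h6 := congrArg f h5
    rw [map_add, map_pow, map_pow, map_pow, hf, map_zero, ha'] at h6
    exact hi₀ h6
  have hnorm : (cyclotomicMarkoffNorm n a : F) = 0 := by
    have h7 : cyclotomicMarkoffNorm n a = Ideal.absNorm (Ideal.span {α}) := by
      rw [Ideal.absNorm_span_singleton]
      rfl
    have h8 := Ideal.absNorm_mem (Ideal.span {α})
    rw [← h7, Ideal.mem_span_singleton] at h8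
    obtain ⟨y, hy⟩ := h8
    have h9 := congrArg f hy
    rw [map_mul, hfα, zero_mul, map_natCast] at h9
    exact h9
  rw [Nat.mem_primeFactors]
  refine ⟨hp, (CharP.cast_eq_zero_iff F p _).1 hnorm, ?_⟩
  change (Algebra.norm ℤ α).natAbs ≠ 0
  rw [Int.natAbs_ne_zero]
  exact Algebra.norm_ne_zero_iff.2 hα0

/-- Few primes carry a point on the Markoff surface whose coordinates all have small order. -/
theorem exists_finset_primes_small_order (M : ℕ) : ∃ B : Finset ℕ, B.card ≤ 5 * M ^ 5 ∧
    ∀ (F : Type) [Field F] [IsAlgClosed F] (p : ℕ) [CharP F p], p.Prime → ∀ n ≤ M, ¬ p ∣ n →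
      ∀ g : Fin 3 → F, (∀ i, g i ^ n = 1) →
      ∑ i, (g i + (g i) ^ (n - 1)) ^ 2 = ∏ i, (g i + (g i) ^ (n - 1)) →
      (∃ i, g i + g i ^ (n - 1) ≠ 0) → p ∈ B := by
  classical
  refine ⟨(Finset.range M).biUnion fun n => (Finset.univ : Finset (Fin 3 → Fin (n + 1))).biUnion
    fun a => (cyclotomicMarkoffNorm (n + 1) fun i => a i).primeFactors, ?_, ?_⟩
  · calc _ ≤ (Finset.range M).card * (M ^ 3 * (5 * M)) := by
          refine Finset.card_biUnion_le_card_mul _ _ _ fun n hn => ?_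
          have hnM : n + 1 ≤ M := Finset.mem_range.1 hn
          refine (Finset.card_biUnion_le_card_mul _ _ (5 * M) fun a _ => ?_).trans ?_
          · exact (card_primeFactors_cyclotomicMarkoffNorm_le _ _).trans (by omega)
          · rw [Finset.card_univ, Fintype.card_fun, Fintype.card_fin, Fintype.card_fin]
            exact Nat.mul_le_mul_right _ (Nat.pow_le_pow_left hnM 3)
      _ = 5 * M ^ 5 := by rw [Finset.card_range]; ring
  · intro F _ _ p _ hp n hn hpn g hg hM ⟨i₀, hi₀⟩
    obtain ⟨n, rfl⟩ := Nat.exists_eq_succ_of_ne_zero (n := n) (by rintro rfl; simp at hpn)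
    obtain ⟨a, ha⟩ := mem_primeFactors_cyclotomicMarkoffNorm hp hpn hg hM hi₀
    rw [Finset.mem_biUnion]
    refine ⟨n, Finset.mem_range.2 hn, ?_⟩
    rw [Finset.mem_biUnion]
    exact ⟨a, Finset.mem_univ _, ha⟩

end Cyclotomic

/-- A predicate on triples that is stable under the Markoff moves for the equation
`x ^ 2 + y ^ 2 + z ^ 2 = x * y * z`, and only holds on solutions of it. -/
structure MarkoffInvariant {K : Type*} [CommRing K] (O : K → K → K → Prop) : Prop where
  swap_left : ∀ {x y z}, O x y z → O y x z
  swap_right : ∀ {x y z}, O x y z → O x z y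
  vieta : ∀ {x y z}, O x y z → O x y (x * y - z)
  eqn : ∀ {x y z}, O x y z → x ^ 2 + y ^ 2 + z ^ 2 = x * y * z

/-- The linear recurrence `u (n + 2) = t * u (n + 1) - u n` with initial values `y`, `z`. -/
def rotSeq {K : Type*} [CommRing K] (t y z : K) : ℕ → K
  | 0 => y
  | 1 => z
  | n + 2 => t * rotSeq t y z (n + 1) - rotSeq t y z n

section rotSeq

variable {K F : Type*} [Field K] [Field F]

theorem map_rotSeq {R S : Type*} [CommRing R] [CommRing S] (f : R →+* S) (t y z : R) (n : ℕ) :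
    f (rotSeq t y z n) = rotSeq (f t) (f y) (f z) n := by
  induction n using Nat.twoStepInduction with
  | zero => rfl
  | one => rfl
  | more n h1 h2 => simp only [rotSeq, map_sub, map_mul, h1, h2]

theorem rotSeq_eq {g t : F} (hg : g ≠ 0) (ht : t = g + g⁻¹) (A B : F) (n : ℕ) :
    rotSeq t (A + B) (A * g + B * g⁻¹) n = A * g ^ n + B * (g ^ n)⁻¹ := by
  induction n using Nat.twoStepInduction with
  | zero => simp [rotSeq]
  | one => simp [rotSeq]
  | more n h1 h2 =>
    rw [rotSeq, h1, h2, ht]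
    field_simp
    ring

theorem exists_rotSeq_coeff {g : F} (hg : g ≠ 0) (hg2 : g ^ 2 ≠ 1) (y z : F) :
    ∃ A B : F, y = A + B ∧ z = A * g + B * g⁻¹ := by
  have h : g ^ 2 - 1 ≠ 0 := sub_ne_zero.2 hg2
  refine ⟨(z * g - y) / (g ^ 2 - 1), (y * g ^ 2 - z * g) / (g ^ 2 - 1), ?_, ?_⟩
  · field_simp
    ring
  · field_simp
    ring

theorem rotSeq_coeff_unique {g : F} (hg : g ≠ 0) (hg2 : g ^ 2 ≠ 1) {A B A' B' : F}
    (h : A + B = A' + B') (h' : A * g + B * g⁻¹ = A' * g + B' * g⁻¹) : A = A' ∧ B = B' := by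
  have h0 : g ^ 2 - 1 ≠ 0 := sub_ne_zero.2 hg2
  field_simp at h'
  have h1 : (g ^ 2 - 1) * (A - A') = 0 := by linear_combination h' - h
  have h2 : A = A' := by
    rcases mul_eq_zero.1 h1 with h1 | h1
    · exact absurd h1 h0
    · exact sub_eq_zero.1 h1
  exact ⟨h2, by linear_combination h - h2⟩

theorem mul_rotSeq_coeff {g t A B : F} (hg : g ≠ 0) (ht : t = g + g⁻¹)
    (h : t ^ 2 + (A + B) ^ 2 + (A * g + B * g⁻¹) ^ 2 = t * (A + B) * (A * g + B * g⁻¹)) :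
    A * B * (t ^ 2 - 4) = t ^ 2 := by
  subst ht
  field_simp at h ⊢
  linear_combination -h

theorem MarkoffInvariant.apply_rotSeq {O : K → K → K → Prop} (hO : MarkoffInvariant O) {t y z : K}
    (h : O t y z) (n : ℕ) : O t (rotSeq t y z n) (rotSeq t y z (n + 1)) := by
  induction n with
  | zero => exact h
  | succ n ih => exact hO.vieta (hO.swap_right ih)

end rotSeq

/-- The possible orders of `g` when `g + g⁻¹` lies in the prime field. -/
def traceOrders (p : ℕ) : Finset ℕ := (p - 1).divisors ∪ (p + 1).divisors

theorem pos_of_mem_traceOrders {p d : ℕ} (hd : d ∈ traceOrders p) : 0 < d := by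
  rw [traceOrders, Finset.mem_union] at hd
  rcases hd with hd | hd <;> exact Nat.pos_of_mem_divisors hd

section orders

open Polynomial

variable {p : ℕ} [Fact p.Prime] {F : Type*} [Field F] [Algebra (ZMod p) F]

theorem exists_eq_add_inv [IsAlgClosed F] [CharP F p] (t : ZMod p) :
    ∃ g : F, g ≠ 0 ∧ algebraMap (ZMod p) F t = g + g⁻¹ ∧ orderOf g ∈ traceOrders p := by
  have hp : p.Prime := Fact.out
  set τ := algebraMap (ZMod p) F t with hτ
  obtain ⟨g, hg⟩ := IsAlgClosed.exists_root (X ^ 2 - C τ * X + 1 : F[X]) (by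
    have : (X ^ 2 - C τ * X + 1 : F[X]).degree = 2 := by compute_degree!
    rw [this]
    norm_num)
  have hg' : g ^ 2 - τ * g + 1 = 0 := by simpa using hg
  have hg0 : g ≠ 0 := by
    rintro rfl
    simp at hg'
  have ht : τ = g + g⁻¹ := by
    field_simp
    linear_combination -hg'
  refine ⟨g, hg0, ht, ?_⟩
  have hfrob : g ^ p + (g ^ p)⁻¹ = g + g⁻¹ := by
    rw [← ht, ← inv_pow, ← add_pow_char, ← ht, hτ, ← map_pow, ZMod.pow_card]
  have hgp : g ^ p ≠ 0 := pow_ne_zero _ hg0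
  have h0 : (g ^ p - g) * (g ^ p * g - 1) = 0 := by
    field_simp at hfrob
    linear_combination hfrob
  rw [traceOrders, Finset.mem_union, Nat.mem_divisors, Nat.mem_divisors]
  rcases mul_eq_zero.1 h0 with h | h
  · refine Or.inl ⟨orderOf_dvd_of_pow_eq_one ?_, by have := hp.two_le; omega⟩
    apply mul_right_cancel₀ hg0
    rw [← pow_succ, Nat.sub_add_cancel hp.one_le, one_mul]
    exact sub_eq_zero.1 h
  · refine Or.inr ⟨orderOf_dvd_of_pow_eq_one ?_, by omega⟩
    rw [pow_succ]
    exact sub_eq_zero.1 h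

theorem not_dvd_of_mem_traceOrders {d : ℕ} (hd : d ∈ traceOrders p) : ¬ p ∣ d := by
  have hp : p.Prime := Fact.out
  rw [traceOrders, Finset.mem_union, Nat.mem_divisors, Nat.mem_divisors] at hd
  intro h
  have h2 := hp.two_le
  rcases hd with hd | hd
  · have := Nat.le_of_dvd (by omega) (h.trans hd.1)
    omega
  · have h3 := (Nat.dvd_add_right (dvd_refl p)).1 (h.trans hd.1)
    have := Nat.le_of_dvd one_pos h3
    omega

theorem card_filter_add_inv_le {L : ℕ} {A B g v : F} (hA : A ≠ 0) (hg : g ≠ 0)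
    (hL : orderOf g = L) [DecidableEq F] :
    ((Finset.range L).filter fun j => A * g ^ j + B * (g ^ j)⁻¹ = v).card ≤ 2 := by
  classical
  set P : F[X] := C A * X ^ 2 - C v * X + C B with hP
  have hPdeg : P.natDegree ≤ 2 := by rw [hP]; compute_degree
  have hP0 : P ≠ 0 := by
    intro h
    have := congrArg (fun q => coeff q 2) h
    simp [hP] at this
    exact hA this
  calc _ ≤ P.roots.toFinset.card := by
        refine Finset.card_le_card_of_injOn (fun j => g ^ j) ?_ ?_
        · intro j hj
          simp only [Finset.coe_filter, Set.mem_ofPred_eq] at hj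
          simp only [SetLike.mem_coe, Multiset.mem_toFinset, mem_roots hP0, IsRoot.def]
          have h1 : g ^ j ≠ 0 := pow_ne_zero _ hg
          have h2 := hj.2
          field_simp at h2
          simp [hP]
          linear_combination h2
        · intro i hi j hj hij
          simp only [Finset.coe_filter, Set.mem_ofPred_eq, Finset.mem_range, ← hL] at hi hj
          exact pow_injOn_Iio_orderOf hi.1 hj.1 hij
    _ ≤ P.natDegree := (Multiset.toFinset_card_le _).trans (card_roots' P)
    _ ≤ 2 := hPdeg

theorem card_le_two_mul_of_forall_order {L : ℕ} {A B g : F} (hA : A ≠ 0) (hg : g ≠ 0)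
    (hL : orderOf g = L) {y : ℕ → ZMod p}
    (hy : ∀ j, algebraMap (ZMod p) F (y j) = A * g ^ j + B * (g ^ j)⁻¹)
    {J : Finset ℕ} (hJ : J ⊆ Finset.range L) :
    J.card ≤ 2 * (J.image y).card := by
  classical
  refine Finset.card_le_mul_card_image J 2 fun v _ => ?_
  refine (Finset.card_le_card ?_).trans
    (card_filter_add_inv_le (v := algebraMap (ZMod p) F v) (B := B) hA hg hL)
  intro j hj
  rw [Finset.mem_filter] at hj ⊢
  exact ⟨hJ hj.1, by rw [← hy, hj.2]⟩

theorem card_le_of_forall_order {d : ℕ} (hd : 0 < d) (S : Finset (ZMod p))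
    (hS : ∀ v ∈ S, ∃ γ : F, algebraMap (ZMod p) F v = γ + γ⁻¹ ∧ orderOf γ = d) : S.card ≤ d := by
  classical
  choose! γ hγ hγd using hS
  calc S.card ≤ (nthRootsFinset d (1 : F)).card := by
        refine Finset.card_le_card_of_injOn γ ?_ ?_
        · intro v hv
          rw [SetLike.mem_coe, mem_nthRootsFinset hd, ← hγd v hv]
          exact pow_orderOf_eq_one _
        · intro v hv w hw hvw
          apply (algebraMap (ZMod p) F).injective
          rw [hγ v hv, hγ w hw, hvw]
    _ ≤ d := by
      rw [nthRootsFinset_def]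
      exact (Multiset.toFinset_card_le _).trans (card_nthRoots _ _)

variable (F) in
theorem exists_popular_order [IsAlgClosed F] [CharP F p] (y : ℕ → ZMod p) (L : ℕ) :
    ∃ d ∈ traceOrders p, ∃ J ⊆ Finset.range L, L ≤ J.card * (traceOrders p).card ∧ ∀ j ∈ J, ∃ γ : F, γ ≠ 0 ∧
      algebraMap (ZMod p) F (y j) = γ + γ⁻¹ ∧ orderOf γ = d := by
  classical
  choose γ hγ0 hγ hγd using fun j => exists_eq_add_inv (F := F) (y j)
  have hD : (traceOrders p).Nonempty := ⟨_, hγd 0⟩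
  rcases Nat.eq_zero_or_pos L with rfl | hL
  · exact ⟨_, hγd 0, ∅, by simp, by simp, by simp⟩
  by_contra! hcon
  have h1 : ∀ d ∈ traceOrders p, ((Finset.range L).filter fun j => orderOf (γ j) = d).card ≤
      (L - 1) / (traceOrders p).card := by
    intro d hd
    rw [Nat.le_div_iff_mul_le hD.card_pos]
    by_contra! h
    obtain ⟨j, hj, hj'⟩ := hcon d hd ((Finset.range L).filter fun j => orderOf (γ j) = d)
      (Finset.filter_subset _ _) (by omega)
    exact hj' (γ j) (hγ0 j) (hγ j) (Finset.mem_filter.1 hj).2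
  have h2 := Finset.card_le_mul_card_image_of_maps_to (s := Finset.range L)
    (f := fun j => orderOf (γ j)) (t := traceOrders p) (fun j _ => hγd j) _ h1
  rw [Finset.card_range] at h2
  have := Nat.div_mul_le_self (L - 1) (traceOrders p).card
  omega

end orders

section middle

variable {p : ℕ} [Fact p.Prime] {F : Type*} [Field F] [Algebra (ZMod p) F]

theorem add_inv_ne_zero {g : F} (hg : g ≠ 0) (h : 4 < orderOf g) : g + g⁻¹ ≠ 0 := by
  intro h0
  field_simp at h0
  exact pow_ne_one_of_lt_orderOf (by norm_num) h (by linear_combination (g ^ 2 - 1) * h0)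

theorem add_inv_sq_sub_four_ne_zero {g : F} (hg : g ≠ 0) (h : 4 < orderOf g) :
    (g + g⁻¹) ^ 2 - 4 ≠ 0 := by
  have h2 := sub_ne_zero.2 (pow_ne_one_of_lt_orderOf (n := 2) (by norm_num)
    (by omega : 2 < orderOf g))
  have : (g + g⁻¹) ^ 2 - 4 = ((g ^ 2 - 1) * g⁻¹) ^ 2 := by
    field_simp
    ring
  rw [this]
  exact pow_ne_zero _ (mul_ne_zero h2 (inv_ne_zero hg))

/-- The coefficients of the rotation orbit on the conic through a point of an invariant set. -/
theorem MarkoffInvariant.exists_coeff {O : ZMod p → ZMod p → ZMod p → Prop}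
    (hO : MarkoffInvariant O) {t y z : ZMod p} (h : O t y z) {g : F} (hg : g ≠ 0)
    (ht : algebraMap (ZMod p) F t = g + g⁻¹) (hg4 : 4 < orderOf g) :
    ∃ A B : F, A ≠ 0 ∧ B ≠ 0 ∧
      A * B * (algebraMap (ZMod p) F t ^ 2 - 4) = algebraMap (ZMod p) F t ^ 2 ∧
      ∀ j, algebraMap (ZMod p) F (rotSeq t y z j) = A * g ^ j + B * (g ^ j)⁻¹ := by
  obtain ⟨A, B, hy, hz⟩ := exists_rotSeq_coeff hg
    (pow_ne_one_of_lt_orderOf (by norm_num) (by omega : 2 < orderOf g))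
    (algebraMap (ZMod p) F y) (algebraMap (ZMod p) F z)
  have heq := congrArg (algebraMap (ZMod p) F) (hO.eqn h)
  simp only [map_add, map_mul, map_pow] at heq
  rw [hy, hz] at heq
  have hAB := mul_rotSeq_coeff hg ht heq
  have ht0 : algebraMap (ZMod p) F t ≠ 0 := ht ▸ add_inv_ne_zero hg hg4
  have hAB0 : A * B ≠ 0 := by
    intro h0
    rw [h0, zero_mul] at hAB
    exact pow_ne_zero 2 ht0 hAB.symm
  refine ⟨A, B, left_ne_zero_of_mul hAB0, right_ne_zero_of_mul hAB0, hAB, fun j => ?_⟩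
  rw [map_rotSeq, hy, hz, rotSeq_eq hg ht]

theorem card_traceOrders_pos (p : ℕ) : 0 < (traceOrders p).card :=
  Finset.card_pos.2 ⟨p + 1, by simp [traceOrders]⟩

theorem MarkoffInvariant.exists_many_of_same_order [IsAlgClosed F] [CharP F p] (hp2 : p ≠ 2)
    {O : ZMod p → ZMod p → ZMod p → Prop} (hO : MarkoffInvariant O)
    {t y z : ZMod p} (h : O t y z) {g : F} (hg : g ≠ 0)
    (ht : algebraMap (ZMod p) F t = g + g⁻¹)
    (hmax : ∀ u v w, O u v w → ∀ γ : F, algebraMap (ZMod p) F u = γ + γ⁻¹ →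
      orderOf γ ≤ orderOf g)
    (hL : 73600 * 201 ^ 6 * (traceOrders p).card ^ 7 ≤ orderOf g) :
    ∃ d : ℕ, ∃ B : Finset (ZMod p),
      (∀ u ∈ B, (∃ v w, O u v w) ∧ ∃ γ : F, γ ≠ 0 ∧ algebraMap (ZMod p) F u = γ + γ⁻¹ ∧
        orderOf γ = d) ∧
      orderOf g ≤ 2 * (traceOrders p).card * B.card ∧ B.card ≤ d ∧
      p < 3417 * (traceOrders p).card * orderOf g := by
  classical
  have hp : p.Prime := Fact.out
  have hDpos := card_traceOrders_pos p
  set D := (traceOrders p).card with hD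
  set L := orderOf g with hLdef
  have hL4 : 4 < L := by
    have : 1 ≤ D ^ 7 := Nat.one_le_pow _ _ hDpos
    omega
  obtain ⟨A, B, hA, hB, hAB, hy⟩ := hO.exists_coeff h hg ht hL4
  obtain ⟨d, hd, J, hJ, hJL, hJd⟩ := exists_popular_order F (rotSeq t y z) L
  have hd0 := pos_of_mem_traceOrders hd
  have hcard1 := card_le_two_mul_of_forall_order hA hg rfl hy hJ
  have hcard2 := card_le_of_forall_order (F := F) hd0 (J.image (rotSeq t y z)) (by
    intro v hv
    obtain ⟨j, hj, rfl⟩ := Finset.mem_image.1 hv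
    obtain ⟨γ, -, h1, h2⟩ := hJd j hj
    exact ⟨γ, h1, h2⟩)
  have hLB : L ≤ 2 * D * (J.image (rotSeq t y z)).card := by
    calc L ≤ J.card * D := hJL
      _ ≤ 2 * (J.image (rotSeq t y z)).card * D := Nat.mul_le_mul_right _ hcard1
      _ = _ := by ring
  refine ⟨d, J.image (rotSeq t y z), ?_, hLB, hcard2, ?_⟩
  · intro v hv
    obtain ⟨j, hj, rfl⟩ := Finset.mem_image.1 hv
    exact ⟨⟨t, _, hO.swap_left (hO.apply_rotSeq h j)⟩, hJd j hj⟩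
  by_contra! hpL
  have hLd : L ≤ 2 * D * d := hLB.trans (Nat.mul_le_mul_left _ hcard2)
  have hJpos : J.Nonempty := by
    rw [← Finset.card_pos]
    by_contra! h0
    simp only [nonpos_iff_eq_zero] at h0
    rw [h0, zero_mul] at hJL
    omega
  have hdL : d ≤ L := by
    obtain ⟨j, hj⟩ := hJpos
    obtain ⟨γ, -, h1, h2⟩ := hJd j hj
    exact h2 ▸ hmax _ _ _ (hO.swap_left (hO.apply_rotSeq h j)) γ h1
  set k := 200 * D + 1 with hk
  have hk6 : 36800 * k ^ 6 ≤ 36800 * 201 ^ 6 * D ^ 6 := by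
    calc 36800 * k ^ 6 ≤ 36800 * (201 * D) ^ 6 := by gcongr; omega
      _ = _ := by ring
  have hkd : 36800 * k ^ 6 ≤ d := by
    refine hk6.trans ?_
    have : (2 * D) * (36800 * 201 ^ 6 * D ^ 6) ≤ (2 * D) * d := by
      refine le_trans (le_of_eq ?_) (hL.trans hLd)
      ring
    exact Nat.le_of_mul_le_mul_left this (by omega)
  have h2 : (2 : F) ≠ 0 := by
    intro h0
    have : ((2 : ℕ) : F) = 0 := by exact_mod_cast h0
    rw [CharP.cast_eq_zero_iff F p, Nat.prime_dvd_prime_iff_eq hp Nat.prime_two] at this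
    exact hp2 this
  have hkL : k ≤ L := by
    refine le_trans ?_ (hkd.trans hdL)
    calc k = k ^ 1 := (pow_one k).symm
      _ ≤ k ^ 6 := Nat.pow_le_pow_right (by omega) (by norm_num)
      _ ≤ 36800 * k ^ 6 := by omega
  have hmain := mul_card_le_of_rootsOfUnity hp h2 hA hB (by
      intro h1
      rw [h1] at hAB
      have : (2 : F) * 2 = 0 := by linear_combination -hAB
      simp [h2] at this) (k := k) (ℓ := L) (d := d) (by omega) (hkd.trans hdL) hkd (by
      calc k ^ 2 + 8 * k * (L + d) ≤ k * L + 8 * k * (L + L) := by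
            rw [sq]
            gcongr
        _ = 17 * k * L := by ring
        _ ≤ 17 * (201 * D) * L := by gcongr; omega
        _ = 3417 * D * L := by ring
        _ ≤ p := hpL) (J.image fun j => g ^ j) (by
      intro h hh
      obtain ⟨j, hj, rfl⟩ := Finset.mem_image.1 hh
      refine ⟨?_, ?_⟩
      · rw [← pow_mul, mul_comm, pow_mul, pow_orderOf_eq_one, one_pow]
      · obtain ⟨γ, h0, h1, h2⟩ := hJd j hj
        refine ⟨γ, h2 ▸ pow_orderOf_eq_one γ, ?_⟩
        rw [div_eq_mul_inv, ← hy, h1, one_div])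
  rw [Finset.card_image_of_injOn] at hmain
  · have h3 : k * L ≤ 200 * D * L := by
      calc k * L ≤ k * (J.card * D) := Nat.mul_le_mul_left _ hJL
        _ = k * J.card * D := by ring
        _ ≤ 100 * (L + L) * D := Nat.mul_le_mul_right _ (hmain.trans (by omega))
        _ = _ := by ring
    have := Nat.le_of_mul_le_mul_right h3 (by omega)
    omega
  · intro i hi j hj hij
    exact pow_injOn_Iio_orderOf (Finset.mem_range.1 (hJ hi)) (Finset.mem_range.1 (hJ hj)) hij

end middle

/-- A set of vectors whose images under `I.card` nearly pairwise independent, equidistributed maps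
all avoid `M` is small. -/
theorem card_mul_card_mul_card_le_of_second_moment {ι V K : Type*} [Fintype V] [DecidableEq V]
    [DecidableEq K] (I : Finset ι) (f : ι → V → K) (M : Finset K) (Q : Finset V) {p : ℕ}
    (hV : Fintype.card V = p ^ 2)
    (h1 : ∀ i ∈ I, (Finset.univ.filter fun v => f i v ∈ M).card = M.card * p)
    (E : ι → Finset ι) (hE : ∀ i ∈ I, (E i).card ≤ 2)
    (h2 : ∀ i ∈ I, ∀ j ∈ I, j ∉ E i → Function.Injective fun v => (f i v, f j v))
    (hQ : ∀ v ∈ Q, ∀ i ∈ I, f i v ∉ M) :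
    Q.card * I.card * M.card ≤ 2 * p ^ 3 := by
  classical
  set c : ι → V → ℤ := fun i v => if f i v ∈ M then 1 else 0 with hc
  set W : V → ℤ := fun v => ∑ i ∈ I, c i v with hW
  set d := (I.card : ℤ) with hd
  set m := (M.card : ℤ) with hm
  have hd0 : 0 ≤ d := by positivity
  have hm0 : 0 ≤ m := by positivity
  have hc1 (i : ι) (hi : i ∈ I) : ∑ v, c i v = m * p := by
    rw [hc, Finset.sum_boole, h1 i hi]
    push_cast
    rfl
  have hS1 : ∑ v, W v = d * (m * p) := by
    rw [hW, Finset.sum_comm, Finset.sum_congr rfl hc1, Finset.sum_const, nsmul_eq_mul]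
  have hpair (i : ι) (hi : i ∈ I) (j : ι) (hj : j ∈ I) :
      ∑ v, c i v * c j v ≤ m ^ 2 + if j ∈ E i then m * p else 0 := by
    split_ifs with hjE
    · calc ∑ v, c i v * c j v ≤ ∑ v, c i v := by
            refine Finset.sum_le_sum fun v _ => ?_
            simp only [hc]
            split_ifs <;> simp
        _ = m * p := hc1 i hi
        _ ≤ _ := by nlinarith
    · have e : ∑ v, c i v * c j v =
          (Finset.univ.filter fun v => f i v ∈ M ∧ f j v ∈ M).card := by
        rw [← Finset.sum_boole]
        refine Finset.sum_congr rfl fun v _ => ?_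
        simp only [hc, ite_and]
        split_ifs <;> simp
      have h3 : (Finset.univ.filter fun v => f i v ∈ M ∧ f j v ∈ M).card ≤ (M ×ˢ M).card := by
        refine Finset.card_le_card_of_injOn (fun v => (f i v, f j v)) ?_ (h2 i hi j hj hjE).injOn
        intro v hv
        simpa using hv
      rw [Finset.card_product, ← sq] at h3
      rw [e, add_zero, hm]
      exact_mod_cast h3
  have hS2 : ∑ v, W v ^ 2 ≤ d * (d * m ^ 2 + 2 * (m * p)) := by
    have e : ∑ v, W v ^ 2 = ∑ i ∈ I, ∑ j ∈ I, ∑ v, c i v * c j v := by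
      simp only [hW, sq, Finset.sum_mul_sum]
      rw [Finset.sum_comm]
      exact Finset.sum_congr rfl fun i _ => Finset.sum_comm
    rw [e, hd, ← nsmul_eq_mul]
    refine Finset.sum_le_card_nsmul _ _ _ fun i hi => ?_
    refine (Finset.sum_le_sum fun j hj => hpair i hi j hj).trans ?_
    rw [Finset.sum_add_distrib, Finset.sum_const, nsmul_eq_mul, ← Finset.sum_filter,
      Finset.sum_const, nsmul_eq_mul]
    have h4 : ((I.filter fun j => j ∈ E i).card : ℤ) ≤ 2 := by
      have : (I.filter fun j => j ∈ E i).card ≤ (E i).card :=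
        Finset.card_le_card fun j hj => (Finset.mem_filter.1 hj).2
      exact_mod_cast this.trans (hE i hi)
    have h5 : 0 ≤ m * p := by positivity
    nlinarith
  have hvar : ∑ v, ((p : ℤ) * W v - d * m) ^ 2 ≤ 2 * (d * m) * p ^ 3 := by
    have e : ∑ v, ((p : ℤ) * W v - d * m) ^ 2 =
        p ^ 2 * ∑ v, W v ^ 2 - 2 * p * (d * m) * ∑ v, W v + p ^ 2 * (d * m) ^ 2 := by
      have h6 : (p : ℤ) ^ 2 * (d * m) ^ 2 = ∑ _v : V, (d * m) ^ 2 := by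
        rw [Finset.sum_const, Finset.card_univ, hV, nsmul_eq_mul]
        push_cast
        rfl
      rw [h6, Finset.mul_sum, Finset.mul_sum, ← Finset.sum_sub_distrib, ← Finset.sum_add_distrib]
      exact Finset.sum_congr rfl fun v _ => by ring
    rw [e, hS1]
    have := mul_le_mul_of_nonneg_left hS2 (sq_nonneg (p : ℤ))
    linear_combination this
  have hlow : (Q.card : ℤ) * (d * m) ^ 2 ≤ ∑ v, ((p : ℤ) * W v - d * m) ^ 2 := by
    calc (Q.card : ℤ) * (d * m) ^ 2 = ∑ v ∈ Q, ((p : ℤ) * W v - d * m) ^ 2 := by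
          rw [← nsmul_eq_mul, ← Finset.sum_const]
          refine Finset.sum_congr rfl fun v hv => ?_
          have : W v = 0 := Finset.sum_eq_zero fun i hi => if_neg (hQ v hv i hi)
          rw [this]
          ring
      _ ≤ _ := Finset.sum_le_univ_sum_of_nonneg fun v => sq_nonneg _
  have hfin := hlow.trans hvar
  rcases (mul_nonneg hd0 hm0).eq_or_lt with h0 | h0
  · have : I.card * M.card = 0 := by
      rw [hd, hm] at h0
      exact_mod_cast h0.symm
    rw [mul_assoc, this]
    positivity
  · have h7 : (Q.card : ℤ) * (d * m) ≤ 2 * p ^ 3 := by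
      refine le_of_mul_le_mul_right ?_ h0
      linear_combination hfin
    rw [mul_assoc]
    rw [hd, hm] at h7
    exact_mod_cast h7

section endgame

variable {p : ℕ} [Fact p.Prime] {F : Type*} [Field F] [Algebra (ZMod p) F]

theorem rotSeq_pair_injective {γ : F} {τ : ZMod p} (hγ : γ ≠ 0) (hγ2 : γ ^ 2 ≠ 1)
    (hτ : algebraMap (ZMod p) F τ = γ + γ⁻¹) {i j : ℕ} (hij : (γ ^ j) ^ 2 ≠ (γ ^ i) ^ 2) :
    Function.Injective fun v : ZMod p × ZMod p =>
      (rotSeq τ v.1 v.2 i, rotSeq τ v.1 v.2 j) := by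
  rintro ⟨y, z⟩ ⟨y', z'⟩ h
  simp only [Prod.mk.injEq] at h
  have hinj := (algebraMap (ZMod p) F).injective
  obtain ⟨A, B, hy, hz⟩ := exists_rotSeq_coeff hγ hγ2 (algebraMap _ F y) (algebraMap _ F z)
  obtain ⟨A', B', hy', hz'⟩ := exists_rotSeq_coeff hγ hγ2 (algebraMap _ F y') (algebraMap _ F z')
  have h1 := congrArg (algebraMap (ZMod p) F) h.1
  have h2 := congrArg (algebraMap (ZMod p) F) h.2
  rw [map_rotSeq, map_rotSeq, hy, hz, hy', hz', rotSeq_eq hγ hτ, rotSeq_eq hγ hτ] at h1 h2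
  have hi : γ ^ i ≠ 0 := pow_ne_zero i hγ
  have hj : γ ^ j ≠ 0 := pow_ne_zero j hγ
  generalize γ ^ i = a at *
  generalize γ ^ j = b at *
  field_simp at h1 h2
  have h3 : (A - A') * (b ^ 2 - a ^ 2) = 0 := by linear_combination h2 - h1
  have hA : A = A' := sub_eq_zero.1 ((mul_eq_zero.1 h3).resolve_right (sub_ne_zero.2 hij))
  have hB : B = B' := by
    subst hA
    linear_combination h1
  rw [Prod.mk.injEq]
  refine ⟨hinj ?_, hinj ?_⟩
  · rw [hy, hy', hA, hB]
  · rw [hz, hz', hA, hB]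

theorem card_filter_rotSeq_mem {γ : F} {τ : ZMod p} (hγ : γ ≠ 0) (hγ2 : γ ^ 2 ≠ 1)
    (hτ : algebraMap (ZMod p) F τ = γ + γ⁻¹) (M : Finset (ZMod p)) (i : ℕ) :
    (Finset.univ.filter fun v : ZMod p × ZMod p => rotSeq τ v.1 v.2 i ∈ M).card = M.card * p := by
  have hinj := rotSeq_pair_injective hγ hγ2 hτ (i := i) (j := i + 1) (by
    intro h
    apply hγ2
    have : (γ ^ i) ^ 2 ≠ 0 := pow_ne_zero _ (pow_ne_zero _ hγ)
    apply mul_left_cancel₀ this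
    rw [mul_one, ← mul_pow, ← pow_succ, h])
  rw [Finset.card_bijective _ (Finite.injective_iff_bijective.1 hinj) (t := M ×ˢ Finset.univ)
    (by simp), Finset.card_product, Finset.card_univ, ZMod.card]

theorem card_filter_pow_sq_eq_le (γ : F) (i : ℕ) [DecidableEq F] :
    ((Finset.range (orderOf γ)).filter fun j => (γ ^ j) ^ 2 = (γ ^ i) ^ 2).card ≤ 2 := by
  refine (Finset.card_le_card_of_injOn (t := {γ ^ i, -γ ^ i}) (fun j => γ ^ j) ?_ ?_).trans
    Finset.card_le_two
  · intro j hj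
    simpa using sq_eq_sq_iff_eq_or_eq_neg.1 (Finset.mem_filter.1 hj).2
  · intro j hj k hk hjk
    exact pow_injOn_Iio_orderOf (Finset.mem_range.1 (Finset.mem_filter.1 hj).1)
      (Finset.mem_range.1 (Finset.mem_filter.1 hk).1) hjk

theorem sq_eq_sq_of_mul_sub_four {c u v : F} (h2 : (2 : F) ≠ 0) (hu : c * (u ^ 2 - 4) = u ^ 2)
    (hv : c * (v ^ 2 - 4) = v ^ 2) : u ^ 2 = v ^ 2 := by
  have hc : c - 1 ≠ 0 := by
    intro hc
    rw [sub_eq_zero.1 hc] at hu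
    have : (2 : F) * 2 = 0 := by linear_combination -hu
    simp [h2] at this
  have : (c - 1) * (u ^ 2 - v ^ 2) = 0 := by linear_combination hu - hv
  exact sub_eq_zero.1 ((mul_eq_zero.1 this).resolve_left hc)

/-- Values that are not coordinates of points of an invariant set are rare as soon as
the set has many coordinates of the same large order. -/
theorem MarkoffInvariant.card_mul_le (h2 : (2 : F) ≠ 0) {O : ZMod p → ZMod p → ZMod p → Prop}
    (hO : MarkoffInvariant O) {d : ℕ} (hd : 4 < d) {B : Finset (ZMod p)}
    (hB : ∀ u ∈ B, (∃ v w, O u v w) ∧ ∃ γ : F, γ ≠ 0 ∧ algebraMap (ZMod p) F u = γ + γ⁻¹ ∧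
      orderOf γ = d) {M : Finset (ZMod p)} (hM : ∀ y ∈ M, ∀ v w, ¬ O y v w) :
    B.card * d * d * M.card ≤ 4 * p ^ 3 := by
  classical
  rcases B.eq_empty_or_nonempty with rfl | ⟨τ, hτB⟩
  · simp
  have hinj := (algebraMap (ZMod p) F).injective
  choose! v w hO' γ hγ0 hγ hγd using fun u hu => (⟨(hB u hu).1.choose,
    (hB u hu).1.choose_spec.choose, (hB u hu).1.choose_spec.choose_spec, (hB u hu).2⟩ : ∃ v w, O u v w ∧ ∃ γ : F, γ ≠ 0 ∧
      algebraMap (ZMod p) F u = γ + γ⁻¹ ∧ orderOf γ = d)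
  choose! a b ha hb hab hseq using fun u hu =>
    hO.exists_coeff (hO' u hu) (hγ0 u hu) (hγ u hu) (by rw [hγd u hu]; exact hd)
  have hγτ2 : γ τ ^ 2 ≠ 1 := pow_ne_one_of_lt_orderOf (by norm_num) (by rw [hγd τ hτB]; omega)
  have hpow : ∀ u ∈ B, ∃ e, γ u ^ e = γ τ := by
    intro u hu
    have h1 := IsPrimitiveRoot.orderOf (γ u)
    rw [hγd u hu] at h1
    have : NeZero d := ⟨by omega⟩
    obtain ⟨e, -, he⟩ := h1.eq_pow_of_pow_eq_one (ξ := γ τ) (by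
      rw [← hγd τ hτB, pow_orderOf_eq_one])
    exact ⟨e, he⟩
  choose! e he using hpow
  let f : ℕ → ZMod p × ZMod p → ZMod p := fun i q => rotSeq τ q.1 q.2 i
  let Φ : ZMod p × ℕ → ZMod p × ZMod p := fun x =>
    (rotSeq x.1 (v x.1) (w x.1) x.2, rotSeq x.1 (v x.1) (w x.1) (x.2 + e x.1))
  have hΦ1 (u : ZMod p) (hu : u ∈ B) (j : ℕ) : algebraMap (ZMod p) F (Φ (u, j)).1 =
      a u * γ u ^ j + b u * (γ u ^ j)⁻¹ := hseq u hu j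
  have hΦ2 (u : ZMod p) (hu : u ∈ B) (j : ℕ) : algebraMap (ZMod p) F (Φ (u, j)).2 =
      a u * γ u ^ j * γ τ + b u * (γ u ^ j)⁻¹ * (γ τ)⁻¹ := by
    simp only [Φ]
    rw [hseq u hu, pow_add, he u hu, mul_inv]
    ring
  have hfΦ (u : ZMod p) (hu : u ∈ B) (j i : ℕ) :
      f i (Φ (u, j)) = rotSeq u (v u) (w u) (j + e u * i) := by
    apply hinj
    simp only [f]
    rw [map_rotSeq, hΦ1 u hu, hΦ2 u hu, rotSeq_eq (hγ0 τ hτB) (hγ τ hτB), hseq u hu, pow_add,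
      pow_mul, he u hu, mul_inv]
    ring
  let Q : Finset (ZMod p × ZMod p) :=
    Finset.univ.filter fun q => ∀ i, ∃ y z, O (f i q) y z
  have hmaps : ∀ x ∈ B ×ˢ Finset.range d, Φ x ∈ Q := by
    rintro ⟨u, j⟩ hx
    have hu := (Finset.mem_product.1 hx).1
    refine Finset.mem_filter.2 ⟨Finset.mem_univ _, fun i => ?_⟩
    rw [hfΦ u hu]
    exact ⟨u, _, hO.swap_left (hO.apply_rotSeq (hO' u hu) _)⟩
  have hfib : ∀ x ∈ B ×ˢ Finset.range d, ∀ x' ∈ B ×ˢ Finset.range d, Φ x = Φ x' →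
      x.1 ^ 2 = x'.1 ^ 2 ∧ (x.1 = x'.1 → x = x') := by
    rintro ⟨u, j⟩ hx ⟨u', j'⟩ hx' hxx
    obtain ⟨hu, hj⟩ := Finset.mem_product.1 hx
    obtain ⟨hu', hj'⟩ := Finset.mem_product.1 hx'
    dsimp only at hu hj hu' hj'
    have e1 := hΦ1 u hu j
    have e2 := hΦ2 u hu j
    rw [hxx] at e1 e2
    obtain ⟨e3, e4⟩ := rotSeq_coeff_unique (hγ0 τ hτB) hγτ2 (e1.symm.trans (hΦ1 u' hu' j'))
      (e2.symm.trans (hΦ2 u' hu' j'))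
    have hprod : a u * b u = a u' * b u' := by
      have h3 := pow_ne_zero j (hγ0 u hu)
      have h4 := pow_ne_zero j' (hγ0 u' hu')
      calc a u * b u = (a u * γ u ^ j) * (b u * (γ u ^ j)⁻¹) := by field_simp
        _ = (a u' * γ u' ^ j') * (b u' * (γ u' ^ j')⁻¹) := by rw [e3, e4]
        _ = a u' * b u' := by field_simp
    constructor
    · apply hinj
      rw [map_pow, map_pow]
      exact sq_eq_sq_of_mul_sub_four h2 (hab u hu) (hprod ▸ hab u' hu')
    · rintro h5
      dsimp only at h5
      subst h5
      have h6 := mul_left_cancel₀ (ha u hu) e3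
      rw [Finset.mem_range, ← hγd u hu] at hj hj'
      rw [pow_injOn_Iio_orderOf hj hj' h6]
  have hcard : (B ×ˢ Finset.range d).card ≤ 2 * Q.card := by
    refine Finset.card_le_mul_card_image_of_maps_to hmaps 2 fun q _ => ?_
    rcases ((B ×ˢ Finset.range d).filter fun x => Φ x = q).eq_empty_or_nonempty with h0 | ⟨x, hx⟩
    · simp [h0]
    rw [Finset.mem_filter] at hx
    refine (Finset.card_le_card_of_injOn (t := {x.1, -x.1}) Prod.fst ?_ ?_).trans
      Finset.card_le_two
    · intro x' hx'
      rw [Finset.mem_coe, Finset.mem_filter] at hx'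
      have := (hfib x' hx'.1 x hx.1 (hx'.2.trans hx.2.symm)).1
      simpa using sq_eq_sq_iff_eq_or_eq_neg.1 this
    · intro x' hx' x'' hx'' hxx
      rw [Finset.mem_coe, Finset.mem_filter] at hx' hx''
      exact (hfib x' hx'.1 x'' hx''.1 (hx'.2.trans hx''.2.symm)).2 hxx
  rw [Finset.card_product, Finset.card_range] at hcard
  have hmain := card_mul_card_mul_card_le_of_second_moment (Finset.range d) f M Q (p := p)
    (by rw [Fintype.card_prod, ZMod.card, sq])
    (fun i _ => card_filter_rotSeq_mem (hγ0 τ hτB) hγτ2 (hγ τ hτB) M i)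
    (fun i => (Finset.range d).filter fun j => (γ τ ^ j) ^ 2 = (γ τ ^ i) ^ 2)
    (fun i _ => by
      have := card_filter_pow_sq_eq_le (γ τ) i
      rwa [hγd τ hτB] at this)
    (fun i _ j hj hij => rotSeq_pair_injective (hγ0 τ hτB) hγτ2 (hγ τ hτB) fun h =>
      hij (Finset.mem_filter.2 ⟨hj, h⟩))
    (fun q hq i _ hi => by
      obtain ⟨y, z, h⟩ := (Finset.mem_filter.1 hq).2 i
      exact hM _ hi y z h)
  rw [Finset.card_range] at hmain
  calc B.card * d * d * M.card = (B.card * d) * (d * M.card) := by ring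
    _ ≤ (2 * Q.card) * (d * M.card) := Nat.mul_le_mul_right _ hcard
    _ = 2 * (Q.card * d * M.card) := by ring
    _ ≤ 2 * (2 * p ^ 3) := Nat.mul_le_mul_left _ hmain
    _ = 4 * p ^ 3 := by ring

end endgame

section orbits

variable {p : ℕ} [Fact p.Prime]

theorem MarkoffInvariant.transfer {O O' : ZMod p → ZMod p → ZMod p → Prop}
    (hO : MarkoffInvariant O) (hO' : MarkoffInvariant O') {g : ZMod p}
    (hg : IsPrimitiveRoot g (p - 1)) (hp : 4 < p - 1) {y z y' z' : ZMod p}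
    (h : O (g + g⁻¹) y z) (h' : O' (g + g⁻¹) y' z') : O' (g + g⁻¹) y z := by
  have hg0 : g ≠ 0 := hg.ne_zero (by omega)
  have hord : 4 < orderOf g := hg.eq_orderOf ▸ hp
  obtain ⟨A, B, hA, hB, hAB, hy⟩ := hO.exists_coeff (F := ZMod p) h hg0 rfl hord
  obtain ⟨A', B', hA', hB', hAB', hy'⟩ := hO'.exists_coeff (F := ZMod p) h' hg0 rfl hord
  simp only [Algebra.algebraMap_self, RingHom.id_apply] at hAB hAB' hy hy'
  have hprod : A * B = A' * B' :=
    mul_right_cancel₀ (add_inv_sq_sub_four_ne_zero hg0 hord) (hAB.trans hAB'.symm)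
  have : NeZero (p - 1) := ⟨by omega⟩
  obtain ⟨n, -, hn⟩ := hg.eq_pow_of_pow_eq_one (ξ := A / A')
    (ZMod.pow_card_sub_one_eq_one (div_ne_zero hA hA'))
  have hAn : A = A' * g ^ n := by rw [hn, mul_div_cancel₀ _ hA']
  have hBn : B = B' * (g ^ n)⁻¹ := by
    have hgn := pow_ne_zero n hg0
    rw [hAn] at hprod
    field_simp
    apply mul_left_cancel₀ hA'
    linear_combination hprod
  have e (k : ℕ) : rotSeq (g + g⁻¹) y z k = rotSeq (g + g⁻¹) y' z' (n + k) := by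
    rw [hy, hy', hAn, hBn, pow_add, mul_inv]
    ring
  have := hO'.apply_rotSeq h' n
  rw [← Nat.add_zero n, ← e 0, Nat.add_zero, ← e 1] at this
  exact this

theorem exists_isPrimitiveRoot_zmod : ∃ g : ZMod p, IsPrimitiveRoot g (p - 1) := by
  obtain ⟨g, hg⟩ := IsCyclic.exists_generator (α := (ZMod p)ˣ)
  have h1 : orderOf g = p - 1 := by
    rw [orderOf_eq_card_of_forall_mem_zpowers hg, Nat.card_eq_fintype_card, ZMod.card_units]
  exact ⟨g, IsPrimitiveRoot.coe_units_iff.2 (h1 ▸ IsPrimitiveRoot.orderOf g)⟩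

/-- The traces `g + g⁻¹` of the primitive roots modulo `p`. -/
noncomputable def primitiveTraces (p : ℕ) [Fact p.Prime] : Finset (ZMod p) :=
  (primitiveRoots (p - 1) (ZMod p)).image fun g => g + g⁻¹

theorem le_card_primitiveTraces :
    p - 1 ≤ 2 * (traceOrders p).card * (primitiveTraces p).card := by
  classical
  have hp : p.Prime := Fact.out
  have hpos : 0 < p - 1 := by have := hp.two_le; omega
  obtain ⟨ζ, hζ⟩ := exists_isPrimitiveRoot_zmod (p := p)
  have h1 : (p - 1).totient ≤ 2 * (primitiveTraces p).card := by
    rw [← hζ.card_primitiveRoots, primitiveTraces]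
    refine Finset.card_le_mul_card_image _ 2 fun v hv => ?_
    obtain ⟨g, hg, rfl⟩ := Finset.mem_image.1 hv
    have hg0 : g ≠ 0 := ((mem_primitiveRoots hpos).1 hg).ne_zero hpos.ne'
    refine (Finset.card_le_card (t := {g, g⁻¹}) ?_).trans Finset.card_le_two
    intro k hk
    rw [Finset.mem_filter, mem_primitiveRoots hpos] at hk
    have hk0 : k ≠ 0 := hk.1.ne_zero hpos.ne'
    have h3 := hk.2
    field_simp at h3
    have h2 : (k - g) * (k * g - 1) = 0 := by linear_combination h3
    rw [Finset.mem_insert, Finset.mem_singleton]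
    rcases mul_eq_zero.1 h2 with h | h
    · exact Or.inl (sub_eq_zero.1 h)
    · exact Or.inr (eq_inv_of_mul_eq_one_left (sub_eq_zero.1 h))
  calc p - 1 ≤ (p - 1).totient * (p - 1).divisors.card := le_totient_mul_card_divisors _
    _ ≤ (2 * (primitiveTraces p).card) * (traceOrders p).card :=
      Nat.mul_le_mul h1 (Finset.card_le_card Finset.subset_union_left)
    _ = _ := by ring

variable {F : Type*} [Field F] [Algebra (ZMod p) F] [IsAlgClosed F] [CharP F p]

theorem orderOf_mem_traceOrders {t : ZMod p} {g : F} (hg : g ≠ 0)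
    (ht : algebraMap (ZMod p) F t = g + g⁻¹) : orderOf g ∈ traceOrders p := by
  obtain ⟨γ, hγ, h, hm⟩ := exists_eq_add_inv (F := F) t
  rw [ht] at h
  field_simp at h
  have h2 : (g - γ) * (g * γ - 1) = 0 := by linear_combination h
  rcases mul_eq_zero.1 h2 with h | h
  · rwa [sub_eq_zero.1 h]
  · rw [eq_inv_of_mul_eq_one_left (sub_eq_zero.1 h)]
    have : orderOf γ⁻¹ = orderOf γ := orderOf_eq_orderOf_iff.2 fun n => by rw [inv_pow, inv_eq_one]
    rwa [this]

theorem MarkoffInvariant.card_le_of_forall_not (hp2 : p ≠ 2)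
    {O : ZMod p → ZMod p → ZMod p → Prop} (hO : MarkoffInvariant O)
    {t y z : ZMod p} (h : O t y z) {g : F} (hg : g ≠ 0)
    (ht : algebraMap (ZMod p) F t = g + g⁻¹)
    (hL : 73600 * 201 ^ 6 * (traceOrders p).card ^ 7 ≤ orderOf g)
    {M : Finset (ZMod p)} (hM : ∀ y ∈ M, ∀ v w, ¬ O y v w) :
    M.card ≤ 4 * 6834 ^ 3 * (traceOrders p).card ^ 6 := by
  classical
  have hp : p.Prime := Fact.out
  obtain ⟨L, hLmem, hLmax⟩ := Finset.exists_max_image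
    ((traceOrders p).filter fun n => ∃ u v w, O u v w ∧ ∃ γ : F, γ ≠ 0 ∧
      algebraMap (ZMod p) F u = γ + γ⁻¹ ∧ orderOf γ = n) id
    ⟨orderOf g, Finset.mem_filter.2
      ⟨orderOf_mem_traceOrders hg ht, t, y, z, h, g, hg, ht, rfl⟩⟩
  have hgL : orderOf g ≤ L := hLmax _ (Finset.mem_filter.2
      ⟨orderOf_mem_traceOrders hg ht, t, y, z, h, g, hg, ht, rfl⟩)
  obtain ⟨-, u, v, w, huvw, γ, hγ0, hγ, rfl⟩ := Finset.mem_filter.1 hLmem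
  obtain ⟨d, B, hB, hLB, hBd, hpL⟩ := hO.exists_many_of_same_order hp2 huvw hγ0 hγ (by
    intro u' v' w' h' γ' hγ'
    by_cases h0 : γ' = 0
    · subst h0
      rw [orderOf_zero]
      exact Nat.zero_le _
    · exact hLmax _ (Finset.mem_filter.2
        ⟨orderOf_mem_traceOrders h0 hγ', u', v', w', h', γ', h0, hγ', rfl⟩)) (hL.trans hgL)
  have hDpos := card_traceOrders_pos p
  have hLc := hL.trans hgL
  set D := (traceOrders p).card
  set L := orderOf γ
  have hd : 4 < d := by
    have h1 : 2 * D * 5 ≤ 2 * D * d := by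
      calc 2 * D * 5 ≤ 73600 * 201 ^ 6 * D ^ 7 := by
            have : D ≤ D ^ 7 := Nat.le_self_pow (by norm_num) D
            omega
        _ ≤ 2 * D * d := hLc.trans (hLB.trans (Nat.mul_le_mul_left _ hBd))
    exact Nat.le_of_mul_le_mul_left h1 (by omega)
  have h2 : (2 : F) ≠ 0 := by
    intro h0
    have : ((2 : ℕ) : F) = 0 := by exact_mod_cast h0
    rw [CharP.cast_eq_zero_iff F p, Nat.prime_dvd_prime_iff_eq hp Nat.prime_two] at this
    exact hp2 this
  have hmain := hO.card_mul_le h2 hd hB hM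
  have hLd : L ≤ 2 * D * d := hLB.trans (Nat.mul_le_mul_left _ hBd)
  have h3 : M.card * p ^ 3 ≤ (4 * 6834 ^ 3 * D ^ 6) * p ^ 3 := by
    calc M.card * p ^ 3 ≤ M.card * (3417 * D * L) ^ 3 := by gcongr
      _ = M.card * (3417 * D) ^ 3 * (L * L * L) := by ring
      _ ≤ M.card * (3417 * D) ^ 3 * ((2 * D * B.card) * (2 * D * d) * (2 * D * d)) := by gcongr
      _ = (6834 ^ 3 * D ^ 6) * (B.card * d * d * M.card) := by ring
      _ ≤ (6834 ^ 3 * D ^ 6) * (4 * p ^ 3) := Nat.mul_le_mul_left _ hmain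
      _ = _ := by ring
  exact Nat.le_of_mul_le_mul_right h3 (pow_pos hp.pos 3)

/-- Any two invariant sets containing a point with a coordinate of large order intersect. -/
theorem MarkoffInvariant.exists_common (hp2 : p ≠ 2)
    {O O' : ZMod p → ZMod p → ZMod p → Prop} (hO : MarkoffInvariant O) (hO' : MarkoffInvariant O')
    (hpD : 73600 * 201 ^ 6 * (traceOrders p).card ^ 7 < p - 1)
    (h : ∃ t y z, O t y z ∧ ∃ g : F, g ≠ 0 ∧ algebraMap (ZMod p) F t = g + g⁻¹ ∧
      73600 * 201 ^ 6 * (traceOrders p).card ^ 7 ≤ orderOf g)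
    (h' : ∃ t y z, O' t y z ∧ ∃ g : F, g ≠ 0 ∧ algebraMap (ZMod p) F t = g + g⁻¹ ∧
      73600 * 201 ^ 6 * (traceOrders p).card ^ 7 ≤ orderOf g) :
    ∃ x y z, O x y z ∧ O' x y z := by
  classical
  obtain ⟨t, y, z, hO1, g, hg, ht, hL⟩ := h
  obtain ⟨t', y', z', hO1', g', hg', ht', hL'⟩ := h'
  have hDpos := card_traceOrders_pos p
  set D := (traceOrders p).card with hD
  have hM := hO.card_le_of_forall_not hp2 hO1 hg ht hL
    (M := (primitiveTraces p).filter fun y => ∀ v w, ¬ O y v w)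
    fun y hy => (Finset.mem_filter.1 hy).2
  have hM' := hO'.card_le_of_forall_not hp2 hO1' hg' ht' hL'
    (M := (primitiveTraces p).filter fun y => ∀ v w, ¬ O' y v w)
    fun y hy => (Finset.mem_filter.1 hy).2
  have hlt : ((primitiveTraces p).filter (fun y => ∀ v w, ¬ O y v w) ∪
      (primitiveTraces p).filter fun y => ∀ v w, ¬ O' y v w).card < (primitiveTraces p).card := by
    refine (Finset.card_union_le _ _).trans_lt ((add_le_add hM hM').trans_lt ?_)
    have h1 := le_card_primitiveTraces (p := p)
    refine lt_of_mul_lt_mul_left (a := 2 * D) (lt_of_lt_of_le ?_ h1) (Nat.zero_le _)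
    refine lt_of_le_of_lt ?_ hpD
    calc 2 * D * (4 * 6834 ^ 3 * D ^ 6 + 4 * 6834 ^ 3 * D ^ 6) = 16 * 6834 ^ 3 * D ^ 7 := by ring
      _ ≤ 73600 * 201 ^ 6 * D ^ 7 := Nat.mul_le_mul_right _ (by norm_num)
  obtain ⟨s, hs, hs'⟩ := Finset.exists_mem_notMem_of_card_lt_card hlt
  rw [Finset.mem_union, Finset.mem_filter, Finset.mem_filter] at hs'
  push Not at hs'
  obtain ⟨v, w, h1⟩ := hs'.1 hs
  obtain ⟨v', w', h2⟩ := hs'.2 hs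
  have hp4 : 4 < p - 1 := by
    have : 1 ≤ D ^ 7 := Nat.one_le_pow _ _ hDpos
    omega
  obtain ⟨k, hk, rfl⟩ := Finset.mem_image.1 hs
  exact ⟨_, _, _, h1, hO.transfer hO' ((mem_primitiveRoots (by omega)).1 hk) hp4 h1 h2⟩

end orbits

/-- Coordinates whose order exceeds this threshold are governed by the rotation argument. -/
def orderThreshold (p : ℕ) : ℕ := 73600 * 201 ^ 6 * (traceOrders p).card ^ 7

theorem MarkoffStep.mem_markoffX_iff {p : ℕ} {a b : ZMod p × ZMod p × ZMod p}
    (h : MarkoffStep p a b) : a ∈ MarkoffX p ↔ b ∈ MarkoffX p := by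
  obtain ⟨x, y, z⟩ := a
  simp only [MarkoffStep] at h
  simp only [MarkoffX, Set.mem_ofPred_eq]
  rcases h with rfl | rfl | rfl | rfl | rfl | rfl <;>
    exact ⟨fun h => by linear_combination h, fun h => by linear_combination h⟩

theorem mem_markoffX_iff_of_eqvGen {p : ℕ} {a b : ZMod p × ZMod p × ZMod p}
    (h : Relation.EqvGen (MarkoffStep p) a b) : a ∈ MarkoffX p ↔ b ∈ MarkoffX p := by
  induction h with
  | rel _ _ h => exact h.mem_markoffX_iff
  | refl _ => exact Iff.rfl
  | symm _ _ _ ih => exact ih.symm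
  | trans _ _ _ _ _ ih₁ ih₂ => exact ih₁.trans ih₂

theorem markoffInvariant_eqvGen {p : ℕ} [Fact p.Prime] (h3 : (3 : ZMod p) ≠ 0)
    {x : ZMod p × ZMod p × ZMod p} (hx : x ∈ MarkoffX p) :
    MarkoffInvariant fun a b c => Relation.EqvGen (MarkoffStep p) x (a / 3, b / 3, c / 3) where
  swap_left h := h.trans _ _ _ (.rel _ _ (Or.inl rfl))
  swap_right h := h.trans _ _ _ (.rel _ _ (Or.inr (Or.inl rfl)))
  vieta {a b c} h := by
    refine h.trans _ _ _ (.rel _ _ ?_)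
    have : (a * b - c) / 3 = 3 * (a / 3) * (b / 3) - c / 3 := by
      field_simp
    rw [this]
    exact Or.inr (Or.inr (Or.inr (Or.inr (Or.inr rfl))))
  eqn {a b c} h := by
    have := (mem_markoffX_iff_of_eqvGen h).1 hx
    simp only [MarkoffX, Set.mem_ofPred_eq] at this
    field_simp at this
    linear_combination this

theorem three_ne_zero_zmod {p : ℕ} (hp : 3 < p) : (3 : ZMod p) ≠ 0 := by
  intro h
  have : ((3 : ℕ) : ZMod p) = 0 := by exact_mod_cast h
  rw [ZMod.natCast_eq_zero_iff] at this
  exact absurd (Nat.le_of_dvd (by norm_num) this) (by omega)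

theorem markoffStrongApprox_of_large_orders {p : ℕ} [Fact p.Prime] (hp : 3 < p)
    {F : Type*} [Field F] [Algebra (ZMod p) F] [IsAlgClosed F] [CharP F p]
    (hpD : orderThreshold p < p - 1)
    (h : ∀ x ∈ MarkoffXstar p, ∃ t ∈ ({3 * x.1, 3 * x.2.1, 3 * x.2.2} : Set (ZMod p)),
      ∃ g : F, g ≠ 0 ∧ algebraMap (ZMod p) F t = g + g⁻¹ ∧ orderThreshold p ≤ orderOf g) :
    MarkoffStrongApprox p := by
  have h3 := three_ne_zero_zmod hp
  have hlarge (x) (hx : x ∈ MarkoffXstar p) : ∃ t y z,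
      Relation.EqvGen (MarkoffStep p) x (t / 3, y / 3, z / 3) ∧ ∃ g : F, g ≠ 0 ∧
      algebraMap (ZMod p) F t = g + g⁻¹ ∧ orderThreshold p ≤ orderOf g := by
    have hO := markoffInvariant_eqvGen h3 hx.1
    have h0 : Relation.EqvGen (MarkoffStep p) x
        (3 * x.1 / 3, 3 * x.2.1 / 3, 3 * x.2.2 / 3) := by
      simp only [mul_div_cancel_left₀ _ h3]
      exact .refl _
    obtain ⟨t, ht, hg⟩ := h x hx
    simp only [Set.mem_insert_iff, Set.mem_singleton_iff] at ht
    rcases ht with rfl | rfl | rfl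
    · exact ⟨_, _, _, h0, hg⟩
    · exact ⟨_, _, _, hO.swap_left h0, hg⟩
    · exact ⟨_, _, _, hO.swap_left (hO.swap_right h0), hg⟩
  refine ⟨⟨(1, 1, 1), ?_, ?_⟩, fun x hx y hy => ?_⟩
  · simp only [MarkoffX, Set.mem_ofPred_eq]
    norm_num
  · simp
  · obtain ⟨a, b, c, hxa, hya⟩ := (markoffInvariant_eqvGen h3 hx.1).exists_common (F := F)
      (by omega) (markoffInvariant_eqvGen h3 hy.1) hpD (hlarge x hx) (hlarge y hy)
    exact hxa.trans _ _ _ (hya.symm _ _)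

theorem exists_finset_not_markoffStrongApprox (N : ℕ) : ∃ B : Finset ℕ, B.card ≤ 5 * N ^ 15 ∧
    ∀ p : ℕ, p.Prime → 3 < p → orderThreshold p < p - 1 → orderThreshold p ≤ N →
      ¬ MarkoffStrongApprox p → p ∈ B := by
  obtain ⟨B, hB, hmem⟩ := exists_finset_primes_small_order (N ^ 3)
  refine ⟨B, hB.trans (by rw [← pow_mul]), fun p hp h3p hpD hpN hSA => ?_⟩
  have : Fact p.Prime := ⟨hp⟩
  let F := AlgebraicClosure (ZMod p)
  have : CharP F p := charP_of_injective_algebraMap (algebraMap (ZMod p) F).injective p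
  have h3 := three_ne_zero_zmod h3p
  obtain ⟨x, hx, hsmall⟩ : ∃ x ∈ MarkoffXstar p,
      ∀ t ∈ ({3 * x.1, 3 * x.2.1, 3 * x.2.2} : Set (ZMod p)), ∀ g : F, g ≠ 0 →
        algebraMap (ZMod p) F t = g + g⁻¹ → orderOf g < orderThreshold p := by
    by_contra! hcon
    exact hSA (markoffStrongApprox_of_large_orders (F := F) h3p hpD hcon)
  let u : Fin 3 → ZMod p := ![3 * x.1, 3 * x.2.1, 3 * x.2.2]
  have hu (i) : u i ∈ ({3 * x.1, 3 * x.2.1, 3 * x.2.2} : Set (ZMod p)) := by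
    fin_cases i <;> simp [u]
  choose g hg0 hg hgm using fun i => exists_eq_add_inv (F := F) (u i)
  set n := ∏ i, orderOf (g i) with hn
  have hpos : 0 < n := Finset.prod_pos fun i _ => pos_of_mem_traceOrders (hgm i)
  have hgn (i) : g i ^ n = 1 := by
    rw [← orderOf_dvd_iff_pow_eq_one]
    exact Finset.dvd_prod_of_mem _ (Finset.mem_univ i)
  have htr (i) : g i + g i ^ (n - 1) = algebraMap (ZMod p) F (u i) := by
    rw [hg i]
    congr 1
    apply eq_inv_of_mul_eq_one_left
    rw [← pow_succ, Nat.sub_add_cancel hpos, hgn]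
  refine hmem F p hp n ?_ ?_ g hgn ?_ ?_
  · calc n ≤ ∏ _i : Fin 3, N := Finset.prod_le_prod' fun i _ =>
          ((hsmall _ (hu i) (g i) (hg0 i) (hg i)).le).trans hpN
      _ = N ^ 3 := by simp
  · rw [hp.prime.dvd_finsetProd_iff]
    rintro ⟨i, -, hi⟩
    exact not_dvd_of_mem_traceOrders (hgm i) hi
  · simp only [htr, ← map_pow]
    rw [← map_sum, ← map_prod]
    congr 1
    have hxe := hx.1
    simp only [MarkoffX, Set.mem_ofPred_eq] at hxe
    simp only [Fin.sum_univ_three, Fin.prod_univ_three, u, Matrix.cons_val]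
    linear_combination 9 * hxe
  · by_contra! hz
    have hz' (i) : u i = 0 := by
      have := hz i
      rw [htr, map_eq_zero] at this
      exact this
    apply hx.2
    have h0 := hz' 0
    have h1 := hz' 1
    have h2 := hz' 2
    simp only [u, Matrix.cons_val, mul_eq_zero, h3, false_or] at h0 h1 h2
    simp only [Set.mem_singleton_iff, Prod.ext_iff]
    exact ⟨h0, h1, h2⟩

theorem exists_orderThreshold_le {δ : ℝ} (hδ : 0 < δ) :
    ∃ C : ℝ, 0 < C ∧ ∀ p : ℕ, 2 ≤ p → (orderThreshold p : ℝ) ≤ C * ((p : ℝ) + 1) ^ δ := by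
  obtain ⟨C, hC, h⟩ := exists_card_divisors_le_rpow (δ := δ / 7) (by positivity)
  refine ⟨73600 * 201 ^ 6 * (2 * C) ^ 7, by positivity, fun p hp => ?_⟩
  have hp1 : (0 : ℝ) ≤ (p : ℝ) + 1 := by positivity
  have hcard : ((traceOrders p).card : ℝ) ≤ 2 * C * ((p : ℝ) + 1) ^ (δ / 7) := by
    have h1 : ((traceOrders p).card : ℝ) ≤ (p - 1).divisors.card + (p + 1).divisors.card := by
      exact_mod_cast Finset.card_union_le _ _
    have h2 := h (p - 1) (by omega)
    have h3 := h (p + 1) (by omega)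
    have h4 : ((p - 1 : ℕ) : ℝ) ^ (δ / 7) ≤ ((p : ℝ) + 1) ^ (δ / 7) := by
      refine Real.rpow_le_rpow (by positivity) ?_ (by positivity)
      have : ((p - 1 : ℕ) : ℝ) ≤ ((p + 1 : ℕ) : ℝ) := by
        exact_mod_cast (by omega : p - 1 ≤ p + 1)
      simpa using this
    push_cast at h3
    have h5 := mul_le_mul_of_nonneg_left h4 (by linarith : 0 ≤ C)
    linarith
  have hpow : (((p : ℝ) + 1) ^ (δ / 7)) ^ 7 = ((p : ℝ) + 1) ^ δ := by
    rw [← Real.rpow_natCast, ← Real.rpow_mul hp1]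
    congr 1
    push_cast
    ring
  rw [orderThreshold, Nat.cast_mul, Nat.cast_pow]
  calc ((73600 * 201 ^ 6 : ℕ) : ℝ) * ((traceOrders p).card : ℝ) ^ 7
      = 73600 * 201 ^ 6 * ((traceOrders p).card : ℝ) ^ 7 := by push_cast; norm_num
    _ ≤ 73600 * 201 ^ 6 * (2 * C * ((p : ℝ) + 1) ^ (δ / 7)) ^ 7 := by gcongr
    _ = 73600 * 201 ^ 6 * (2 * C) ^ 7 * (((p : ℝ) + 1) ^ (δ / 7)) ^ 7 := by ring
    _ = _ := by rw [hpow]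

theorem markoff_exceptional_primes_sparse :
    ∀ ε : ℝ, 0 < ε → ∃ T₀ : ℕ, ∀ T : ℕ, T₀ ≤ T →
      (({p : ℕ | p ≤ T ∧ p.Prime ∧ ¬ MarkoffStrongApprox p}.ncard : ℝ)) ≤ (T : ℝ) ^ ε := by
  intro ε hε
  set δ : ℝ := min (ε / 30) (1 / 2) with hδdef
  have hδ : 0 < δ := by positivity
  have hδ1 : δ ≤ 1 / 2 := min_le_right _ _
  have hδ2 : δ ≤ ε / 30 := min_le_left _ _
  obtain ⟨C, hC, hthr⟩ := exists_orderThreshold_le hδ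
  set P : ℕ := ⌈(C + 2) ^ 2⌉₊ + 4 with hP
  have hlarge : ∀ p : ℕ, P ≤ p → orderThreshold p < p - 1 := by
    intro p hp
    have h1 : (C + 2) ^ 2 ≤ (p : ℝ) + 1 := by
      have h2 : ((⌈(C + 2) ^ 2⌉₊ : ℕ) : ℝ) ≤ p := by exact_mod_cast (by omega)
      have := Nat.le_ceil ((C + 2) ^ 2)
      linarith
    have h2 : C + 2 ≤ √((p : ℝ) + 1) := Real.le_sqrt_of_sq_le h1
    have h3 : ((p : ℝ) + 1) ^ δ ≤ √((p : ℝ) + 1) := by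
      rw [Real.sqrt_eq_rpow]
      exact Real.rpow_le_rpow_of_exponent_le (by linarith [(p.cast_nonneg : (0 : ℝ) ≤ p)]) hδ1
    have h4 : √((p : ℝ) + 1) ^ 2 = (p : ℝ) + 1 := Real.sq_sqrt (by positivity)
    have h5 := hthr p (by omega)
    have h6 : (orderThreshold p : ℝ) + 1 < p := by
      nlinarith [mul_le_mul_of_nonneg_left h3 hC.le]
    have h7 : orderThreshold p + 1 < p := by exact_mod_cast h6
    omega
  set K : ℝ := P + 5 * C ^ 15 * 2 ^ (ε / 2) with hK
  obtain ⟨X, hX⟩ := Filter.eventually_atTop.1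
    ((tendsto_rpow_atTop (half_pos hε)).eventually_ge_atTop K)
  refine ⟨max 1 ⌈X⌉₊, fun T hT => ?_⟩
  have hT1 : (1 : ℝ) ≤ T := by exact_mod_cast (le_max_left _ _).trans hT
  have hTX : X ≤ T := (Nat.le_ceil X).trans (by exact_mod_cast (le_max_right _ _).trans hT)
  have hTK := hX T hTX
  set N : ℕ := ⌊C * ((T : ℝ) + 1) ^ δ⌋₊ with hN
  obtain ⟨B, hB, hmem⟩ := exists_finset_not_markoffStrongApprox N
  have hsub : {p : ℕ | p ≤ T ∧ p.Prime ∧ ¬ MarkoffStrongApprox p} ⊆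
      ((Finset.range P ∪ B : Finset ℕ) : Set ℕ) := by
    rintro p ⟨hpT, hp, hSA⟩
    rw [Finset.mem_coe, Finset.mem_union, Finset.mem_range]
    by_contra! hcon
    refine hcon.2 (hmem p hp (by omega) (hlarge p hcon.1) ?_ hSA)
    refine Nat.le_floor ((hthr p hp.two_le).trans ?_)
    gcongr
  have hcard : ({p : ℕ | p ≤ T ∧ p.Prime ∧ ¬ MarkoffStrongApprox p}.ncard : ℝ) ≤
      P + 5 * (N : ℝ) ^ 15 := by
    have h1 := Set.ncard_le_ncard hsub (Finset.finite_toSet _)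
    rw [Set.ncard_coe_finset] at h1
    have h2 := h1.trans ((Finset.card_union_le _ _).trans (Nat.add_le_add_left hB _))
    rw [Finset.card_range] at h2
    exact_mod_cast h2
  have hNpow : (N : ℝ) ^ 15 ≤ C ^ 15 * (2 ^ (ε / 2) * (T : ℝ) ^ (ε / 2)) := by
    have h1 : (N : ℝ) ≤ C * ((T : ℝ) + 1) ^ δ := Nat.floor_le (by positivity)
    have h2 : (N : ℝ) ≤ C * (2 * (T : ℝ)) ^ (ε / 30) := by
      refine h1.trans (mul_le_mul_of_nonneg_left ?_ hC.le)
      calc ((T : ℝ) + 1) ^ δ ≤ (2 * (T : ℝ)) ^ δ :=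
            Real.rpow_le_rpow (by positivity) (by linarith) hδ.le
        _ ≤ _ := Real.rpow_le_rpow_of_exponent_le (by linarith) hδ2
    calc (N : ℝ) ^ 15 ≤ (C * (2 * (T : ℝ)) ^ (ε / 30)) ^ 15 :=
          pow_le_pow_left₀ (by positivity) h2 15
      _ = C ^ 15 * ((2 * (T : ℝ)) ^ (ε / 30)) ^ 15 := by ring
      _ = C ^ 15 * (2 * (T : ℝ)) ^ (ε / 2) := by
        rw [← Real.rpow_natCast (_ ^ (ε / 30)), ← Real.rpow_mul (by positivity)]
        congr 2
        push_cast
        ring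
      _ = _ := by rw [Real.mul_rpow (by norm_num) (by positivity)]
  have hTpos : (1 : ℝ) ≤ (T : ℝ) ^ (ε / 2) := Real.one_le_rpow hT1 (by positivity)
  calc _ ≤ (P : ℝ) + 5 * (N : ℝ) ^ 15 := hcard
    _ ≤ P * (T : ℝ) ^ (ε / 2) + 5 * (C ^ 15 * (2 ^ (ε / 2) * (T : ℝ) ^ (ε / 2))) := by
      gcongr
      exact le_mul_of_one_le_right (by positivity) hTpos
    _ = K * (T : ℝ) ^ (ε / 2) := by rw [hK]; ring
    _ ≤ (T : ℝ) ^ (ε / 2) * (T : ℝ) ^ (ε / 2) := by gcongr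
    _ = (T : ℝ) ^ ε := by
      rw [← Real.rpow_add (by linarith)]
      congr 1
      ring
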